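/- arXiv:2404.12946 — 11 statements merged into one kernel-verified Lean document; each statement's English description precedes it below -/
import Mathlib

section
/- Let T be an (α,β)-RK operator on a complex Banach space X with α, β ≥ 0 and β < 1. Then the spectrum σ(T) of T is contained in 𝔻 ∪ {1}, where 𝔻 is the open unit disk; that is, every λ ∈ ℂ with |λ| = 1 and λ ≠ 1 belongs to the resolvent set of T. -/
/-- A bounded linear operator `T` on a complex Banach space is `(α,β)`-RK with constant `C` if
`C ≥ 1` and for every `λ ∈ ℂ` with `|λ| > 1` the operator `λI − T` is invertible with
`‖(λI − T)⁻¹‖ ≤ C |λ|^(α+β−1) / (|λ−1|^α (|λ|−1)^β)`. -/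
def IsRK {X : Type*} [NormedAddCommGroup X] [NormedSpace ℂ X]
    (T : X →L[ℂ] X) (α β C : ℝ) : Prop :=
  1 ≤ C ∧ ∀ lam : ℂ, 1 < ‖lam‖ →
    IsUnit (algebraMap ℂ (X →L[ℂ] X) lam - T) ∧
    ‖Ring.inverse (algebraMap ℂ (X →L[ℂ] X) lam - T)‖ ≤
      C * ‖lam‖ ^ (α + β - 1) / (‖lam - 1‖ ^ α * (‖lam‖ - 1) ^ β)

/-- If `‖(λI − T)⁻¹‖ · |λ − μ| < 1`, then `μ` lies in the resolvent set of `T`. -/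
theorem isUnit_sub_of_norm_inverse_mul_lt_one {A : Type*} [NormedRing A] [NormedAlgebra ℂ A]
    [CompleteSpace A] {a : A} {lam μ : ℂ} (hu : IsUnit (algebraMap ℂ A lam - a))
    (h : ‖Ring.inverse (algebraMap ℂ A lam - a)‖ * ‖lam - μ‖ < 1) :
    IsUnit (algebraMap ℂ A μ - a) := by
  have h1 : IsUnit (1 - (lam - μ) • Ring.inverse (algebraMap ℂ A lam - a)) := by
    apply isUnit_one_sub_of_norm_lt_one
    rwa [norm_smul, mul_comm]
  have h2 : algebraMap ℂ A μ - a = (algebraMap ℂ A lam - a) *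
      (1 - (lam - μ) • Ring.inverse (algebraMap ℂ A lam - a)) := by
    rw [mul_sub, mul_smul_comm, Ring.mul_inverse_cancel _ hu, mul_one,
      ← Algebra.algebraMap_eq_smul_one, map_sub]
    abel
  rw [h2]
  exact hu.mul h1

open Filter Topology in
/-- At a unimodular point `μ ≠ 1`, the RK bound with `β < 1` is `o(1 / (r - 1))` along the
radius `r ↦ r μ`. -/
theorem tendsto_rk_bound_mul_sub_one {μ : ℂ} (hμ1 : μ ≠ 1) (α C γ : ℝ) {β : ℝ}
    (hβ1 : β < 1) :
    Tendsto (fun r : ℝ => C * r ^ γ / (‖(r : ℂ) * μ - 1‖ ^ α * (r - 1) ^ β) * (r - 1))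
      (𝓝[>] 1) (𝓝 0) := by
  have hne : ‖((1 : ℝ) : ℂ) * μ - 1‖ ≠ 0 := by simpa [sub_eq_zero] using hμ1
  have hc : ContinuousAt
      (fun r : ℝ => C * r ^ γ / ‖(r : ℂ) * μ - 1‖ ^ α * (r - 1) ^ (1 - β)) 1 := by
    refine ((continuousAt_const.mul (continuousAt_id.rpow_const (Or.inl one_ne_zero))).div
      (ContinuousAt.rpow_const (by fun_prop) (Or.inl hne)) ?_).mul
      (ContinuousAt.rpow_const (by fun_prop) (Or.inr (by linarith)))
    exact (Real.rpow_pos_of_pos (lt_of_le_of_ne (norm_nonneg _) hne.symm) _).ne'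
  have ht := hc.tendsto.mono_left (nhdsWithin_le_nhds (s := Set.Ioi 1))
  rw [sub_self, Real.zero_rpow (by linarith), mul_zero] at ht
  refine ht.congr' ?_
  filter_upwards [self_mem_nhdsWithin] with r hr
  have hr' : 0 < r - 1 := sub_pos.mpr hr
  rw [Real.rpow_sub hr', Real.rpow_one]
  simp only [div_eq_mul_inv, mul_inv]
  ring

/-- The spectrum of an `(α,β)`-RK operator with `β < 1` is contained in `𝔻 ∪ {1}`. -/
theorem spectrum_subset_ball_union_one
    {X : Type*} [NormedAddCommGroup X] [NormedSpace ℂ X] [CompleteSpace X]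
    (T : X →L[ℂ] X) (α β C : ℝ) (hα : 0 ≤ α) (hβ : 0 ≤ β) (hβ1 : β < 1)
    (hT : IsRK T α β C) :
    spectrum ℂ T ⊆ Metric.ball (0 : ℂ) 1 ∪ {1} := by
  intro μ hμ
  by_contra hout
  simp only [Set.mem_union, Metric.mem_ball, dist_zero_right, Set.mem_singleton_iff, not_or,
    not_lt] at hout
  obtain ⟨hge, hμ1⟩ := hout
  rcases hge.lt_or_eq with hgt | heq
  · exact hμ (hT.2 μ hgt).1
  · obtain ⟨r, hlt, hr⟩ := (((tendsto_rk_bound_mul_sub_one hμ1 α C (α + β - 1)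
      hβ1).eventually_lt_const one_pos).and self_mem_nhdsWithin).exists
    have hr : 1 < r := hr
    have hnorm : ‖(r : ℂ) * μ‖ = r := by
      rw [norm_mul, ← heq, mul_one, Complex.norm_real, Real.norm_of_nonneg (by linarith)]
    have hdist : ‖(r : ℂ) * μ - μ‖ = r - 1 := by
      rw [← sub_one_mul, norm_mul, ← heq, mul_one, ← Complex.ofReal_one, ← Complex.ofReal_sub,
        Complex.norm_real, Real.norm_of_nonneg (by linarith)]
    obtain ⟨hu, hb⟩ := hT.2 ((r : ℂ) * μ) (by rwa [hnorm])
    refine hμ (isUnit_sub_of_norm_inverse_mul_lt_one hu (lt_of_le_of_lt ?_ hlt))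
    rw [hnorm] at hb
    rw [hdist]
    exact mul_le_mul_of_nonneg_right hb (by linarith)
end

section
/- Let T be an (α,0)-RK operator on a complex Banach space X with α ≥ 0 and constant C ≥ 1. Then for every λ ∈ ℂ with |λ| = 1 and λ ≠ 1, the operator λI − T is invertible and ‖(λI − T)^{-1}‖ ≤ C / |λ−1|^α. -/
open Filter Topology in
/-- A limit of units whose inverses are eventually bounded is a unit. -/
theorem isUnit_of_tendsto_of_norm_inverse_le {R ι : Type*} [NormedRing R] [HasSummableGeomSeries R]
    {l : Filter ι} [l.NeBot] {f : ι → R} {a : R} {K : ℝ} (hf : Tendsto f l (𝓝 a))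
    (hu : ∀ᶠ i in l, IsUnit (f i)) (hK : ∀ᶠ i in l, ‖Ring.inverse (f i)‖ ≤ K) : IsUnit a := by
  have hlim : Tendsto (fun i ↦ Ring.inverse (f i) * (a - f i)) l (𝓝 0) := by
    have hsub : Tendsto (fun i ↦ a - f i) l (𝓝 0) := by simpa using hf.const_sub a
    exact isBoundedUnder_le_mul_tendsto_zero ⟨K, eventually_map.2 hK⟩ hsub
  have hone : Tendsto (fun i ↦ 1 + Ring.inverse (f i) * (a - f i)) l (𝓝 ((1 : Rˣ) : R)) := by
    simpa using hlim.const_add 1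
  obtain ⟨i, hi, hi'⟩ := (hu.and (hone.eventually (Units.nhds 1))).exists
  have ha : a = f i * (1 + Ring.inverse (f i) * (a - f i)) := by
    rw [mul_add, ← mul_assoc, Ring.mul_inverse_cancel _ hi]
    simp
  rw [ha]
  exact hi.mul hi'

open Filter Topology in
/-- For an `(α,0)`-RK operator with constant `C`, on the unit circle minus `{1}` the operator
`λI − T` is invertible and `‖(λI − T)⁻¹‖ ≤ C / |λ−1|^α`. -/
theorem resolvent_estimate_on_circle_beta_zero
    {X : Type*} [NormedAddCommGroup X] [NormedSpace ℂ X] [CompleteSpace X]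
    (T : X →L[ℂ] X) (α C : ℝ) (hα : 0 ≤ α) (hT : IsRK T α 0 C) :
    ∀ lam : ℂ, ‖lam‖ = 1 → lam ≠ 1 →
      IsUnit (algebraMap ℂ (X →L[ℂ] X) lam - T) ∧
      ‖Ring.inverse (algebraMap ℂ (X →L[ℂ] X) lam - T)‖ ≤ C / ‖lam - 1‖ ^ α := by
  intro lam hlam hne
  have hpos : 0 < ‖lam - 1‖ := norm_pos_iff.2 (sub_ne_zero.2 hne)
  have hpow : ‖lam - 1‖ ^ α ≠ 0 := (Real.rpow_pos_of_pos hpos α).ne'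
  have hpath : Tendsto (fun t : ℝ ↦ (t : ℂ) * lam) (𝓝[>] 1) (𝓝 lam) := by
    have h : Continuous fun t : ℝ ↦ (t : ℂ) * lam := by fun_prop
    simpa using (h.tendsto 1).mono_left nhdsWithin_le_nhds
  have hout : ∀ᶠ t : ℝ in 𝓝[>] 1, 1 < ‖(t : ℂ) * lam‖ := by
    filter_upwards [self_mem_nhdsWithin] with t ht
    have ht : 1 < t := ht
    rwa [norm_mul, hlam, mul_one, Complex.norm_real, Real.norm_of_nonneg (by linarith)]
  have hop : Tendsto (fun t : ℝ ↦ algebraMap ℂ (X →L[ℂ] X) (t * lam) - T) (𝓝[>] 1)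
      (𝓝 (algebraMap ℂ (X →L[ℂ] X) lam - T)) :=
    (((continuous_algebraMap ℂ (X →L[ℂ] X)).tendsto lam).comp hpath).sub_const T
  have hbound : Tendsto (fun t : ℝ ↦ C * ‖(t : ℂ) * lam‖ ^ (α - 1) / ‖(t : ℂ) * lam - 1‖ ^ α)
      (𝓝[>] 1) (𝓝 (C / ‖lam - 1‖ ^ α)) := by
    have h₁ := (hpath.norm.rpow_const (p := α - 1) (Or.inl (by simp [hlam]))).const_mul C
    have h₂ := (hpath.sub_const 1).norm.rpow_const (p := α) (Or.inl hpos.ne')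
    simpa [hlam, Pi.div_def] using h₁.div h₂ hpow
  have hle : ∀ᶠ t : ℝ in 𝓝[>] 1, ‖Ring.inverse (algebraMap ℂ (X →L[ℂ] X) (t * lam) - T)‖ ≤
      C * ‖(t : ℂ) * lam‖ ^ (α - 1) / ‖(t : ℂ) * lam - 1‖ ^ α := by
    filter_upwards [hout] with t ht
    simpa only [add_zero, Real.rpow_zero, mul_one] using (hT.2 _ ht).2
  have hK := (hle.and (hbound.eventually_le_const (lt_add_one _))).mono fun t h ↦ h.1.trans h.2
  have hunit : IsUnit (algebraMap ℂ (X →L[ℂ] X) lam - T) :=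
    isUnit_of_tendsto_of_norm_inverse_le hop (hout.mono fun t ht ↦ (hT.2 _ ht).1) hK
  refine ⟨hunit, le_of_tendsto_of_tendsto ?_ hbound hle⟩
  obtain ⟨u, hu⟩ := hunit
  rw [← hu] at hop ⊢
  exact ((NormedRing.inverse_continuousAt u).tendsto.comp hop).norm
end

section
/- Let T be an (α,β)-RK operator on a complex Banach space X with constant C ≥ 1, where 0 < β < 1 and α + β ≤ 1. Then for every λ ∈ ℂ with |λ| = 1 and λ ≠ 1, the operator λI − T is invertible and ‖(λI − T)^{-1}‖ ≤ C^{1/(1−β)} / (β^{β/(1−β)} (1−β) |λ−1|^{α/(1−β)}). -/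
/-- Perturbing a unit `a` by a scalar `c` with `‖c‖ * ‖a⁻¹‖ ≤ b < 1` yields a unit whose inverse
has norm at most `‖a⁻¹‖ / (1 - b)`. -/
theorem isUnit_sub_algebraMap_and_norm_inverse_le {A : Type*} [NormedRing A] [NormedAlgebra ℂ A]
    [HasSummableGeomSeries A] {a : A} (ha : IsUnit a) {c : ℂ} {b : ℝ}
    (hb : b < 1) (hc : ‖c‖ * ‖Ring.inverse a‖ ≤ b) :
    IsUnit (a - algebraMap ℂ A c) ∧
      ‖Ring.inverse (a - algebraMap ℂ A c)‖ ≤ ‖Ring.inverse a‖ / (1 - b) := by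
  have hfac : a - algebraMap ℂ A c = a * (1 - c • Ring.inverse a) := by
    rw [mul_sub, mul_one, mul_smul_comm, Ring.mul_inverse_cancel a ha,
      Algebra.algebraMap_eq_smul_one]
  have hunit : IsUnit (a - algebraMap ℂ A c) := by
    rw [hfac]
    refine ha.mul (isUnit_one_sub_of_norm_lt_one ?_)
    rw [norm_smul]
    exact hc.trans_lt hb
  refine ⟨hunit, ?_⟩
  set v := Ring.inverse (a - algebraMap ℂ A c) with hv
  have hres : v = Ring.inverse a + c • (Ring.inverse a * v) := by
    have h1 : (a - algebraMap ℂ A c) * v = 1 := Ring.mul_inverse_cancel _ hunit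
    have h2 : a * v = 1 + c • v := by
      rw [sub_mul, Algebra.algebraMap_eq_smul_one, smul_mul_assoc, one_mul] at h1
      rw [← h1, sub_add_cancel]
    calc v = Ring.inverse a * (a * v) := by
          rw [← mul_assoc, Ring.inverse_mul_cancel a ha, one_mul]
      _ = _ := by rw [h2, mul_add, mul_one, mul_smul_comm]
  have hnorm : ‖v‖ ≤ ‖Ring.inverse a‖ + b * ‖v‖ := by
    calc ‖v‖ = ‖Ring.inverse a + c • (Ring.inverse a * v)‖ := congrArg norm hres
      _ ≤ ‖Ring.inverse a‖ + ‖c‖ * (‖Ring.inverse a‖ * ‖v‖) := by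
          refine (norm_add_le _ _).trans ?_
          rw [norm_smul]
          gcongr
          exact norm_mul_le _ _
      _ ≤ _ := by
          rw [← mul_assoc]
          gcongr
  rw [le_div_iff₀ (by linarith)]
  linarith

/-- Moving a point of the unit circle radially outwards increases its distance to `1`. -/
theorem norm_sub_one_le_norm_real_mul_sub_one {z : ℂ} (hz : ‖z‖ = 1) {r : ℝ} (hr : 1 ≤ r) :
    ‖z - 1‖ ≤ ‖(r : ℂ) * z - 1‖ := by
  have hsq : z.re * z.re + z.im * z.im = 1 := by
    rw [← Complex.normSq_apply, Complex.normSq_eq_norm_sq, hz, one_pow]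
  have hre : z.re ≤ 1 := hz ▸ Complex.re_le_norm z
  refine (sq_le_sq₀ (norm_nonneg _) (norm_nonneg _)).mp ?_
  rw [← Complex.normSq_eq_norm_sq, ← Complex.normSq_eq_norm_sq, Complex.normSq_apply,
    Complex.normSq_apply]
  simp only [Complex.sub_re, Complex.sub_im, Complex.one_re, Complex.one_im,
    Complex.re_ofReal_mul, Complex.im_ofReal_mul]
  nlinarith [mul_nonneg (sub_nonneg.2 hr) (sub_nonneg.2 hre), sq_nonneg (r - 1)]

/-- For an `(α,β)`-RK operator with `0 < β < 1` and `α + β ≤ 1`, on the unit circle minus `{1}`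
one has `‖(λI − T)⁻¹‖ ≤ C^(1/(1−β)) / (β^(β/(1−β)) (1−β) |λ−1|^(α/(1−β)))`. -/
theorem resolvent_estimate_on_circle_sum_le_one
    {X : Type*} [NormedAddCommGroup X] [NormedSpace ℂ X] [CompleteSpace X]
    (T : X →L[ℂ] X) (α β C : ℝ) (hα : 0 ≤ α) (hβ : 0 < β) (hβ1 : β < 1)
    (hsum : α + β ≤ 1) (hT : IsRK T α β C) :
    ∀ lam : ℂ, ‖lam‖ = 1 → lam ≠ 1 →
      IsUnit (algebraMap ℂ (X →L[ℂ] X) lam - T) ∧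
      ‖Ring.inverse (algebraMap ℂ (X →L[ℂ] X) lam - T)‖ ≤
        C ^ ((1 : ℝ) / (1 - β)) / (β ^ (β / (1 - β)) * (1 - β) * ‖lam - 1‖ ^ (α / (1 - β))) := by
  intro lam hlam hne
  obtain ⟨hC, hR⟩ := hT
  have hC0 : 0 < C := by linarith
  have hb : 0 < 1 - β := by linarith
  have hd : 0 < ‖lam - 1‖ := norm_pos_iff.2 (sub_ne_zero.2 hne)
  have hdα : 0 < ‖lam - 1‖ ^ α := Real.rpow_pos_of_pos hd α
  set A : ℝ := C / ‖lam - 1‖ ^ α with hA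
  have hA0 : 0 < A := div_pos hC0 hdα
  -- the radial step that minimises the bound given by the Neumann series
  set δ : ℝ := (β / A) ^ (1 / (1 - β)) with hδ
  have hδ0 : 0 < δ := Real.rpow_pos_of_pos (div_pos hβ hA0) _
  have hδβ : δ ^ β = (β / A) ^ (β / (1 - β)) := by
    rw [hδ, ← Real.rpow_mul (div_pos hβ hA0).le, one_div_mul_eq_div]
  have hδ1 : δ = δ ^ β * (β / A) := by
    have h : δ ^ (1 - β) = β / A := by
      rw [hδ, ← Real.rpow_mul (div_pos hβ hA0).le, one_div_mul_cancel hb.ne', Real.rpow_one]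
    rw [← h, ← Real.rpow_add hδ0, add_sub_cancel, Real.rpow_one]
  have hδβ0 : 0 < δ ^ β := Real.rpow_pos_of_pos hδ0 β
  set μ : ℂ := ((1 + δ : ℝ) : ℂ) * lam with hμ
  have hμn : ‖μ‖ = 1 + δ := by
    rw [hμ, norm_mul, hlam, mul_one, Complex.norm_of_nonneg (by linarith)]
  obtain ⟨hu, hle⟩ := hR μ (by linarith)
  have hK : ‖Ring.inverse (algebraMap ℂ (X →L[ℂ] X) μ - T)‖ ≤ A / δ ^ β := by
    refine hle.trans ?_
    rw [hA, div_div, hμn, add_sub_cancel_left]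
    have h1 : (1 + δ) ^ (α + β - 1) ≤ 1 :=
      Real.rpow_le_one_of_one_le_of_nonpos (by linarith) (by linarith)
    have h2 : ‖lam - 1‖ ≤ ‖μ - 1‖ :=
      norm_sub_one_le_norm_real_mul_sub_one hlam (by linarith)
    gcongr
    exact mul_le_of_le_one_right hC0.le h1
  have hc : ‖(δ : ℂ) * lam‖ * ‖Ring.inverse (algebraMap ℂ (X →L[ℂ] X) μ - T)‖ ≤ β := by
    rw [norm_mul, hlam, mul_one, Complex.norm_of_nonneg hδ0.le]
    calc _ ≤ δ * (A / δ ^ β) := by gcongr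
      _ = δ ^ β * (β / A) * (A / δ ^ β) := by rw [← hδ1]
      _ = β := by field_simp
  have hshift : algebraMap ℂ (X →L[ℂ] X) μ - T - algebraMap ℂ (X →L[ℂ] X) ((δ : ℂ) * lam)
      = algebraMap ℂ (X →L[ℂ] X) lam - T := by
    rw [sub_right_comm, ← map_sub, hμ]
    congr 2
    push_cast
    ring
  obtain ⟨hunit, hnorm⟩ := isUnit_sub_algebraMap_and_norm_inverse_le hu hβ1 hc
  rw [hshift] at hunit hnorm
  refine ⟨hunit, hnorm.trans ?_⟩
  have hAp : A ^ (1 / (1 - β)) = A * A ^ (β / (1 - β)) := by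
    rw [← Real.rpow_one_add' hA0.le (by positivity)]
    congr 1
    field_simp
    ring
  have hAd : A ^ (1 / (1 - β)) = C ^ (1 / (1 - β)) / ‖lam - 1‖ ^ (α / (1 - β)) := by
    rw [hA, Real.div_rpow hC0.le hdα.le, ← Real.rpow_mul hd.le, mul_one_div]
  calc _ ≤ A / δ ^ β / (1 - β) := by gcongr
    _ = A ^ (1 / (1 - β)) / (β ^ (β / (1 - β)) * (1 - β)) := by
        rw [hδβ, Real.div_rpow hβ.le hA0.le, hAp, div_div_eq_mul_div, div_div]
    _ = _ := by rw [hAd, div_div, mul_comm (‖lam - 1‖ ^ _)]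
end

section
/- Let T be an (α,β)-RK operator on a complex Banach space X with constant C ≥ 1, where 0 < β < 1 and α + β > 1. Then for every λ ∈ ℂ with |λ| = 1 and λ ≠ 1, the operator λI − T is invertible and ‖(λI − T)^{-1}‖ ≤ C^{1/(1−β)} 2^{α/(1−β)} / (β^{β/(1−β)} (1−β) |λ−1|^{α/(1−β)}). -/
/-- Perturbation of the inverse in a complete normed ring. -/
theorem isUnit_and_norm_inverse_le_of_norm_sub_mul_le {A : Type*} [NormedRing A] [CompleteSpace A]
    {a b : A} {q : ℝ} (ha : IsUnit a) (hq : q < 1) (h : ‖a - b‖ * ‖Ring.inverse a‖ ≤ q) :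
    IsUnit b ∧ ‖Ring.inverse b‖ ≤ ‖Ring.inverse a‖ / (1 - q) := by
  have hfac : b = a * (1 - Ring.inverse a * (a - b)) := by
    rw [mul_sub, ← mul_assoc, Ring.mul_inverse_cancel a ha]
    simp
  have hsmall : ‖Ring.inverse a * (a - b)‖ < 1 :=
    (norm_mul_le _ _).trans_lt (by rw [mul_comm]; exact h.trans_lt hq)
  have hb : IsUnit b := by
    rw [hfac]
    exact ha.mul (isUnit_one_sub_of_norm_lt_one hsmall)
  refine ⟨hb, ?_⟩
  have hres : Ring.inverse b = Ring.inverse a + Ring.inverse a * (a - b) * Ring.inverse b := by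
    rw [mul_sub, Ring.inverse_mul_cancel a ha, sub_mul, mul_assoc, Ring.mul_inverse_cancel b hb]
    simp
  have hle : ‖Ring.inverse b‖ ≤ ‖Ring.inverse a‖ + q * ‖Ring.inverse b‖ := by
    calc ‖Ring.inverse b‖
        = ‖Ring.inverse a + Ring.inverse a * (a - b) * Ring.inverse b‖ := by rw [← hres]
      _ ≤ ‖Ring.inverse a‖ + ‖Ring.inverse a‖ * ‖a - b‖ * ‖Ring.inverse b‖ :=
          (norm_add_le _ _).trans (by gcongr; exact norm_mul₃_le)
      _ ≤ ‖Ring.inverse a‖ + q * ‖Ring.inverse b‖ := by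
          rw [mul_comm ‖Ring.inverse a‖]
          gcongr
  rw [le_div_iff₀ (by linarith)]
  linarith

/-- Radial lower bound for the distance to `1` from a point outside the unit disc. -/
theorem mul_norm_sub_one_div_two_le {z : ℂ} {r : ℝ} (hz : ‖z‖ = 1) (hr : 1 ≤ r) :
    r * ‖z - 1‖ / 2 ≤ ‖(r : ℂ) * z - 1‖ := by
  have hn : ‖(r : ℂ) * z‖ = r := by
    rw [norm_mul, hz, Complex.norm_of_nonneg (by linarith), mul_one]
  have h1 : r - 1 ≤ ‖(r : ℂ) * z - 1‖ := by
    simpa only [hn, norm_one] using norm_sub_norm_le ((r : ℂ) * z) 1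
  have h2 : r * ‖z - 1‖ ≤ ‖(r : ℂ) * z - 1‖ + (r - 1) := by
    calc r * ‖z - 1‖ = ‖((r : ℂ) * z - 1) - ((r - 1 : ℝ) : ℂ)‖ := by
          rw [← Complex.norm_of_nonneg (show 0 ≤ r by linarith), ← norm_mul,
            Complex.norm_of_nonneg (show 0 ≤ r by linarith)]
          congr 1
          push_cast
          ring
      _ ≤ ‖(r : ℂ) * z - 1‖ + (r - 1) := by
          refine (norm_sub_le _ _).trans ?_
          rw [Complex.norm_of_nonneg (by linarith)]
  linarith

/-- The resolvent bound of an `(α,β)`-RK operator at the point `r z`, where `r = 1 / (1 - t)`. -/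
theorem IsRK.norm_inverse_le {X : Type*} [NormedAddCommGroup X] [NormedSpace ℂ X]
    {T : X →L[ℂ] X} {α β C : ℝ} (hT : IsRK T α β C) (hα : 0 ≤ α) {z : ℂ} (hz : ‖z‖ = 1)
    (hz1 : z ≠ 1) {r t : ℝ} (hr : 1 < r) (ht : 0 < t) (hrt : r - 1 = r * t) :
    ‖Ring.inverse (algebraMap ℂ (X →L[ℂ] X) (r * z) - T)‖ ≤
      C * 2 ^ α / ‖z - 1‖ ^ α * t ^ (-β) / r := by
  have hr0 : 0 < r := by linarith
  have ha : 0 < ‖z - 1‖ := norm_pos_iff.2 (sub_ne_zero.2 hz1)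
  have hC : 0 ≤ C := zero_le_one.trans hT.1
  have hn : ‖(r : ℂ) * z‖ = r := by
    rw [norm_mul, hz, Complex.norm_of_nonneg hr0.le, mul_one]
  refine (hT.2 (r * z) (by rwa [hn])).2.trans ?_
  rw [hn, hrt]
  calc C * r ^ (α + β - 1) / (‖(r : ℂ) * z - 1‖ ^ α * (r * t) ^ β)
      ≤ C * r ^ (α + β - 1) / ((r * ‖z - 1‖ / 2) ^ α * (r * t) ^ β) := by
        have := mul_norm_sub_one_div_two_le hz hr.le
        gcongr
    _ = C * 2 ^ α / ‖z - 1‖ ^ α * t ^ (-β) / r := by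
        rw [Real.div_rpow (by positivity) (by positivity), Real.mul_rpow hr0.le ha.le,
          Real.mul_rpow hr0.le ht.le, Real.rpow_sub hr0, Real.rpow_add hr0, Real.rpow_neg ht.le,
          Real.rpow_one]
        field_simp


/-- For an `(α,β)`-RK operator with `0 < β < 1` and `α + β > 1`, on the unit circle minus `{1}`
one has `‖(λI − T)⁻¹‖ ≤ C^(1/(1−β)) 2^(α/(1−β)) / (β^(β/(1−β)) (1−β) |λ−1|^(α/(1−β)))`. -/
theorem resolvent_estimate_on_circle_sum_gt_one
    {X : Type*} [NormedAddCommGroup X] [NormedSpace ℂ X] [CompleteSpace X]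
    (T : X →L[ℂ] X) (α β C : ℝ) (hα : 0 ≤ α) (hβ : 0 < β) (hβ1 : β < 1)
    (hsum : 1 < α + β) (hT : IsRK T α β C) :
    ∀ lam : ℂ, ‖lam‖ = 1 → lam ≠ 1 →
      IsUnit (algebraMap ℂ (X →L[ℂ] X) lam - T) ∧
      ‖Ring.inverse (algebraMap ℂ (X →L[ℂ] X) lam - T)‖ ≤
        C ^ ((1 : ℝ) / (1 - β)) * 2 ^ (α / (1 - β)) /
          (β ^ (β / (1 - β)) * (1 - β) * ‖lam - 1‖ ^ (α / (1 - β))) := by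
  intro lam hl hl1
  have hβ' : 0 < 1 - β := by linarith
  have ha : 0 < ‖lam - 1‖ := norm_pos_iff.2 (sub_ne_zero.2 hl1)
  have ha2 : ‖lam - 1‖ ≤ 2 := (norm_sub_le _ _).trans (by rw [hl, norm_one]; norm_num)
  have hC : 0 < C := zero_lt_one.trans_le hT.1
  set K : ℝ := C * 2 ^ α / ‖lam - 1‖ ^ α with hK
  have hK1 : 1 ≤ K := by
    rw [hK, one_le_div (by positivity)]
    calc ‖lam - 1‖ ^ α ≤ 2 ^ α := by gcongr
      _ ≤ C * 2 ^ α := le_mul_of_one_le_left (by positivity) hT.1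
  have hK0 : 0 < K := by linarith
  set t : ℝ := (β / K) ^ (1 / (1 - β)) with ht_def
  have ht : 0 < t := by positivity
  have ht1 : t < 1 :=
    Real.rpow_lt_one (by positivity) ((div_lt_one hK0).2 (by linarith)) (by positivity)
  have ht' : 0 < 1 - t := by linarith
  have hr : 1 < 1 / (1 - t) := by
    rw [lt_div_iff₀ ht']
    linarith
  have hrt : 1 / (1 - t) - 1 = 1 / (1 - t) * t := by
    field_simp
    ring
  generalize 1 / (1 - t) = r at hr hrt
  have hr0 : 0 < r := by linarith
  have hR := hT.norm_inverse_le hα hl hl1 hr ht hrt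
  rw [← hK] at hR
  have htβ : K * t ^ (-β) * t = β := by
    rw [mul_assoc, ← Real.rpow_add_one ht.ne', neg_add_eq_sub, ht_def,
      ← Real.rpow_mul (by positivity), one_div_mul_cancel hβ'.ne', Real.rpow_one]
    field_simp
  have hKt : K * t ^ (-β) = C ^ (1 / (1 - β)) * 2 ^ (α / (1 - β)) /
      (β ^ (β / (1 - β)) * ‖lam - 1‖ ^ (α / (1 - β))) := by
    have hKpow : K * K ^ (β / (1 - β)) = K ^ (1 / (1 - β)) := by
      rw [mul_comm, ← Real.rpow_add_one hK0.ne']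
      congr 1
      field_simp
      ring
    have htpow : t ^ (-β) = K ^ (β / (1 - β)) / β ^ (β / (1 - β)) := by
      rw [ht_def, ← Real.rpow_mul (by positivity), show 1 / (1 - β) * -β = -(β / (1 - β)) by ring,
        Real.rpow_neg (by positivity), Real.div_rpow hβ.le hK0.le, inv_div]
    rw [htpow, mul_div_assoc', hKpow, hK, Real.div_rpow (by positivity) (by positivity),
      Real.mul_rpow hC.le (by positivity), ← Real.rpow_mul (by positivity),
      ← Real.rpow_mul (by positivity), mul_one_div, div_div, mul_comm (β ^ _)]
  have hdist : ‖(algebraMap ℂ (X →L[ℂ] X) (r * lam) - T) - (algebraMap ℂ (X →L[ℂ] X) lam - T)‖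
      ≤ r * t := by
    have : (algebraMap ℂ (X →L[ℂ] X) (r * lam) - T) - (algebraMap ℂ (X →L[ℂ] X) lam - T)
        = (((r - 1 : ℝ) : ℂ) * lam) • ContinuousLinearMap.id ℂ X := by
      rw [sub_sub_sub_cancel_right, ← map_sub, Algebra.algebraMap_eq_smul_one]
      congr 1
      push_cast
      ring
    rw [this, norm_smul, norm_mul, hl, Complex.norm_of_nonneg (by linarith), hrt, mul_one]
    exact mul_le_of_le_one_right (by positivity) ContinuousLinearMap.norm_id_le
  have hunit := (hT.2 (r * lam) (by
    rwa [norm_mul, hl, Complex.norm_of_nonneg hr0.le, mul_one])).1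
  obtain ⟨hu, hle⟩ := isUnit_and_norm_inverse_le_of_norm_sub_mul_le hunit hβ1
    (calc _ ≤ r * t * (K * t ^ (-β) / r) := by gcongr
      _ = K * t ^ (-β) * t := by field_simp
      _ = β := htβ)
  refine ⟨hu, hle.trans ?_⟩
  calc _ ≤ K * t ^ (-β) / (1 - β) := by
        gcongr
        exact hR.trans (div_le_self (by positivity) hr.le)
    _ = _ := by
        rw [hKt, div_div]
        congr 1
        ring
end

section
/- Let T be an (α,β)-RK operator on a complex Banach space X with α, β ≥ 0, β < 1 and α + β < 1. Then the powers of T decay exponentially: there exist constants ω > 0 and M > 0 such that ‖T^n‖ ≤ M e^{−ω n} for all n ∈ ℕ. -/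
open Filter

/-- If `lam` lies in the resolvent set of `a` and `mu` is closer to `lam` than `‖(lam - a)⁻¹‖⁻¹`,
then `mu` lies in the resolvent set of `a` too. -/
theorem spectrum.notMem_of_norm_sub_mul_norm_inverse_lt_one {𝕜 A : Type*}
    [NontriviallyNormedField 𝕜] [NormedRing A] [NormedAlgebra 𝕜 A] [CompleteSpace A] {a : A}
    {lam mu : 𝕜} (hu : IsUnit (algebraMap 𝕜 A lam - a))
    (h : ‖lam - mu‖ * ‖Ring.inverse (algebraMap 𝕜 A lam - a)‖ < 1) : mu ∉ spectrum 𝕜 a := by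
  rw [spectrum.notMem_iff]
  have h1 : IsUnit (1 - (lam - mu) • Ring.inverse (algebraMap 𝕜 A lam - a)) :=
    isUnit_one_sub_of_norm_lt_one ((norm_smul_le _ _).trans_lt h)
  have h2 := hu.mul h1
  rw [mul_sub, mul_one, mul_smul_comm, Ring.mul_inverse_cancel _ hu,
    ← Algebra.algebraMap_eq_smul_one, map_sub] at h2
  convert h2 using 1
  abel

/-- In a complex Banach algebra, the powers of an element of spectral radius less than one decay
exponentially. -/
theorem exists_norm_pow_le_exp_of_spectralRadius_lt_one {A : Type*} [NormedRing A]
    [NormedAlgebra ℂ A] [CompleteSpace A] {a : A} (ha : spectralRadius ℂ a < 1) :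
    ∃ ω > (0 : ℝ), ∃ M > (0 : ℝ), ∀ n : ℕ, ‖a ^ n‖ ≤ M * Real.exp (-ω * n) := by
  obtain ⟨r, har, hr1⟩ := ENNReal.lt_iff_exists_nnreal_btwn.mp ha
  have hr0 : 0 < (r : ℝ) := by exact_mod_cast pos_of_gt har
  have hr1 : (r : ℝ) < 1 := by exact_mod_cast hr1
  have hev : ∀ᶠ n : ℕ in atTop, ‖a ^ n‖ ≤ (r : ℝ) ^ n := by
    filter_upwards [(spectrum.pow_nnnorm_pow_one_div_tendsto_nhds_spectralRadius a).eventually_lt_const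
      har, eventually_gt_atTop 0] with n hn hn0
    have hn0' : (0 : ℝ) < n := by exact_mod_cast hn0
    rw [one_div, ENNReal.rpow_inv_lt_iff hn0', ENNReal.rpow_natCast] at hn
    exact_mod_cast hn.le
  have hexp (n : ℕ) : Real.exp (-(-Real.log r) * n) = (r : ℝ) ^ n := by
    rw [neg_neg, mul_comm, Real.exp_nat_mul, Real.exp_log hr0]
  obtain ⟨N, hN⟩ := eventually_atTop.mp hev
  have hnonneg (k : ℕ) : 0 ≤ ‖a ^ k‖ / (r : ℝ) ^ k := by positivity
  refine ⟨-Real.log r, neg_pos.mpr (Real.log_neg hr0 hr1),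
    1 + ∑ k ∈ Finset.range N, ‖a ^ k‖ / (r : ℝ) ^ k, by positivity, fun n ↦ ?_⟩
  rw [hexp, ← div_le_iff₀ (by positivity)]
  rcases le_or_gt N n with h | h
  · exact ((div_le_one (by positivity)).mpr (hN n h)).trans
      (le_add_of_nonneg_right (Finset.sum_nonneg fun k _ ↦ hnonneg k))
  · exact (Finset.single_le_sum (fun k _ ↦ hnonneg k) (Finset.mem_range.mpr h)).trans
      (le_add_of_nonneg_left zero_le_one)

/-- The spectrum of an `(α,β)`-RK operator with `α + β < 1` lies in the open unit disc. -/
theorem IsRK.norm_lt_one_of_mem_spectrum {X : Type*} [NormedAddCommGroup X] [NormedSpace ℂ X]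
    [CompleteSpace X] {T : X →L[ℂ] X} {α β C : ℝ} (hT : IsRK T α β C) (hα : 0 ≤ α)
    (hsum : α + β < 1) {mu : ℂ} (hmu : mu ∈ spectrum ℂ T) : ‖mu‖ < 1 := by
  obtain ⟨hC, hres⟩ := hT
  by_contra! hge
  rcases hge.lt_or_eq with hgt | heq
  · exact hmu (hres mu hgt).1
  obtain ⟨s, hs, hCs⟩ : ∃ s > (0 : ℝ), C * s ^ (1 - (α + β)) < 1 := by
    refine ⟨(2 * C)⁻¹ ^ (1 - (α + β))⁻¹, by positivity, ?_⟩
    rw [Real.rpow_inv_rpow (by positivity) (by linarith)]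
    field_simp
    norm_num
  have hlam : ‖((1 + s : ℝ) : ℂ) * mu‖ = 1 + s := by
    rw [norm_mul, ← heq, mul_one, Complex.norm_real, Real.norm_of_nonneg (by positivity)]
  obtain ⟨hu, hb⟩ := hres (((1 + s : ℝ) : ℂ) * mu) (by rw [hlam]; linarith)
  refine spectrum.notMem_of_norm_sub_mul_norm_inverse_lt_one hu ?_ hmu
  have hdist : ‖((1 + s : ℝ) : ℂ) * mu - mu‖ = s := by
    rw [show ((1 + s : ℝ) : ℂ) * mu - mu = (s : ℂ) * mu by push_cast; ring, norm_mul, ← heq,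
      mul_one, Complex.norm_real, Real.norm_of_nonneg hs.le]
  have hs_le : s ≤ ‖((1 + s : ℝ) : ℂ) * mu - 1‖ := by
    have := norm_sub_norm_le (((1 + s : ℝ) : ℂ) * mu) 1
    rw [hlam, norm_one] at this
    linarith
  rw [hlam, add_sub_cancel_left] at hb
  rw [hdist]
  have hpow : (1 + s) ^ (α + β - 1) ≤ 1 :=
    Real.rpow_le_one_of_one_le_of_nonpos (by linarith) (by linarith)
  calc s * ‖Ring.inverse (algebraMap ℂ (X →L[ℂ] X) (((1 + s : ℝ) : ℂ) * mu) - T)‖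
      ≤ s * (C * 1 / (s ^ α * s ^ β)) := by
        refine mul_le_mul_of_nonneg_left (hb.trans ?_) hs.le
        gcongr
    _ = C * s ^ (1 - (α + β)) := by
        rw [Real.rpow_sub hs, Real.rpow_one, Real.rpow_add hs]
        ring
    _ < 1 := hCs

/-- For an `(α,β)`-RK operator with `β < 1` and `α + β < 1`, the powers of `T` decay
exponentially. -/
theorem powers_exponential_decay_of_sum_lt_one
    {X : Type*} [NormedAddCommGroup X] [NormedSpace ℂ X] [CompleteSpace X]
    (T : X →L[ℂ] X) (α β C : ℝ) (hα : 0 ≤ α) (hβ : 0 ≤ β) (hβ1 : β < 1)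
    (hsum : α + β < 1) (hT : IsRK T α β C) :
    ∃ ω > (0 : ℝ), ∃ M > (0 : ℝ), ∀ n : ℕ, ‖T ^ n‖ ≤ M * Real.exp (-ω * n) := by
  refine exists_norm_pow_le_exp_of_spectralRadius_lt_one ?_
  rcases subsingleton_or_nontrivial (X →L[ℂ] X) with h | h
  · simp [spectrum.SpectralRadius.of_subsingleton]
  · refine spectrum.spectralRadius_lt_of_forall_lt (r := 1) T fun z hz ↦ ?_
    exact_mod_cast hT.norm_lt_one_of_mem_spectrum hα hsum hz
end

section
/- Let T be an (α,β)-RK operator on a complex Banach space X with constant C ≥ 1, where β < 1 and α + β > 1. Then σ(T) is contained in the closure of the (α/(1−β))-Stolz domain S_σ^{α/(1−β)} with parameter σ = 2 C_{α,β}, where C_{α,β} := C if β = 0, and C_{α,β} := C^{1/(1−β)} 2^{α/(1−β)} / (β^{β/(1−β)} (1−β)) if β > 0. -/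
/-- For `σ > 0` and `γ > 0`, the `γ`-Stolz domain
`S_σ^γ := { z ∈ 𝔻 : |1−z|^γ/(1−|z|) < σ } ∪ {1}`. -/
def stolzDomain (γ σ : ℝ) : Set ℂ :=
  {z : ℂ | ‖z‖ < 1 ∧ ‖1 - z‖ ^ γ / (1 - ‖z‖) < σ} ∪ {1}

open Filter Topology

theorem IsRK.norm_sub_one_rpow_mul_le {X : Type*} [NormedAddCommGroup X] [NormedSpace ℂ X]
    [CompleteSpace X] {T : X →L[ℂ] X} {α β C : ℝ} (hT : IsRK T α β C) {z lam : ℂ}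
    (hz : z ∈ spectrum ℂ T) (hlam : 1 < ‖lam‖) :
    ‖lam - 1‖ ^ α * (‖lam‖ - 1) ^ β ≤ C * ‖lam‖ ^ (α + β - 1) * ‖lam - z‖ := by
  obtain ⟨⟨u, hu⟩, hb⟩ := hT.2 lam hlam
  have hne : 0 < ‖lam - 1‖ := by
    rw [norm_pos_iff, sub_ne_zero]
    rintro rfl
    simp at hlam
  have hD : 0 < ‖lam - 1‖ ^ α * (‖lam‖ - 1) ^ β :=
    mul_pos (Real.rpow_pos_of_pos hne _) (Real.rpow_pos_of_pos (by linarith) _)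
  rw [← hu, Ring.inverse_unit, le_div_iff₀ hD] at hb
  have hdist : ¬ ‖(algebraMap ℂ (X →L[ℂ] X) z - T) - u‖ < ‖(↑u⁻¹ : X →L[ℂ] X)‖⁻¹ := fun h ↦
    hz ⟨Units.ofNearby u _ h, rfl⟩
  rw [hu, sub_sub_sub_cancel_right, ← map_sub, not_lt, Algebra.algebraMap_eq_smul_one] at hdist
  have hle : ‖(↑u⁻¹ : X →L[ℂ] X)‖⁻¹ ≤ ‖lam - z‖ := by
    refine hdist.trans ((norm_smul_le _ _).trans ?_)
    rw [norm_sub_rev]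
    exact mul_le_of_le_one_right (norm_nonneg _) ContinuousLinearMap.norm_id_le
  have hpos : 0 < ‖(↑u⁻¹ : X →L[ℂ] X)‖ := by
    rw [norm_pos_iff]
    intro h0
    apply hz
    have : (1 : X →L[ℂ] X) = 0 := by rw [← u.inv_mul, h0, zero_mul]
    have := subsingleton_of_zero_eq_one this.symm
    exact isUnit_of_subsingleton _
  have h1 : 1 ≤ ‖lam - z‖ * ‖(↑u⁻¹ : X →L[ℂ] X)‖ := (inv_le_iff_one_le_mul₀ hpos).mp hle
  calc ‖lam - 1‖ ^ α * (‖lam‖ - 1) ^ β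
      ≤ ‖lam - z‖ * ‖(↑u⁻¹ : X →L[ℂ] X)‖ * (‖lam - 1‖ ^ α * (‖lam‖ - 1) ^ β) :=
        le_mul_of_one_le_left hD.le h1
    _ = ‖lam - z‖ * (‖(↑u⁻¹ : X →L[ℂ] X)‖ * (‖lam - 1‖ ^ α * (‖lam‖ - 1) ^ β)) := by ring
    _ ≤ ‖lam - z‖ * (C * ‖lam‖ ^ (α + β - 1)) := by gcongr
    _ = _ := by ring

theorem norm_ofReal_mul_sub_one_sq {e : ℂ} (he : ‖e‖ = 1) (s : ℝ) :
    ‖s * e - 1‖ ^ 2 = (s - 1) ^ 2 + s * ‖e - 1‖ ^ 2 := by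
  have h : e.re * e.re + e.im * e.im = 1 := by
    rw [← Complex.normSq_apply, ← Complex.sq_norm, he, one_pow]
  simp only [Complex.sq_norm, Complex.normSq_apply, Complex.sub_re, Complex.sub_im,
    Complex.re_ofReal_mul, Complex.im_ofReal_mul, Complex.one_re, Complex.one_im]
  linear_combination (s ^ 2 - s) * h

theorem norm_sub_one_le_norm_ofReal_mul_sub_one {e : ℂ} (he : ‖e‖ = 1) {r : ℝ} (hr : 1 ≤ r) :
    ‖e - 1‖ ≤ ‖r * e - 1‖ := by
  refine le_of_sq_le_sq ?_ (norm_nonneg _)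
  rw [norm_ofReal_mul_sub_one_sq he]
  nlinarith [sq_nonneg (r - 1), sq_nonneg ‖e - 1‖]

theorem exists_norm_eq_one_eq_norm_mul (z : ℂ) :
    ∃ e : ℂ, ‖e‖ = 1 ∧ z = ‖z‖ * e ∧ (0 < ‖z‖ ∨ e ≠ 1) := by
  rcases eq_or_ne z 0 with rfl | hz
  · exact ⟨-1, by simp, by simp, Or.inr (by norm_num)⟩
  · have h : ‖z‖ ≠ 0 := norm_ne_zero_iff.mpr hz
    refine ⟨z / ‖z‖, by simp [h], ?_, Or.inl (norm_pos_iff.mpr hz)⟩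
    rw [mul_div_cancel₀]
    exact_mod_cast h

/-- A radial comparison: for `γ > 1`, the power `|1 - z|^γ` is controlled by the distance
`d = 1 - |z|` to the circle and by the chord `x = |1 - z / |z||`. -/
theorem sq_add_mul_sq_rpow_lt {d x γ : ℝ} (hd : 0 < d) (hd1 : d ≤ 1) (hx : 0 ≤ x) (hγ : 1 < γ)
    (h : d < 1 ∨ 0 < x) : (d ^ 2 + (1 - d) * x ^ 2) ^ (γ / 2) < d + x ^ γ := by
  have hpow : ∀ y : ℝ, 0 ≤ y → (y ^ 2) ^ (γ / 2) = y ^ γ := fun y hy ↦ by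
    rw [← Real.rpow_natCast, ← Real.rpow_mul hy]
    congr 1
    push_cast
    ring
  have hxγ : 0 ≤ x ^ γ := Real.rpow_nonneg hx _
  rcases hd1.eq_or_lt with rfl | hlt
  · have : 0 < x ^ γ := Real.rpow_pos_of_pos (h.resolve_left (lt_irrefl _)) _
    simpa using this
  rcases le_total 1 (γ / 2) with h2 | h2
  · have hconv := (convexOn_rpow h2).2 (Set.mem_Ici.mpr hd.le) (Set.mem_Ici.mpr (sq_nonneg x))
      hd.le (sub_nonneg.mpr hd1) (add_sub_cancel d 1)
    simp only [smul_eq_mul] at hconv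
    rw [hpow x hx] at hconv
    have hlt1 : d ^ (γ / 2) < 1 := Real.rpow_lt_one hd.le hlt (by linarith)
    rw [sq d]
    nlinarith
  · have hsub := Real.rpow_add_le_add_rpow (sq_nonneg d)
      (mul_nonneg (sub_nonneg.mpr hd1) (sq_nonneg x)) (by linarith : 0 ≤ γ / 2) h2
    rw [hpow d hd.le, Real.mul_rpow (sub_nonneg.mpr hd1) (sq_nonneg x), hpow x hx] at hsub
    have hdγ : d ^ γ < d := by
      simpa using Real.rpow_lt_rpow_of_exponent_gt hd hlt hγ
    have : (1 - d) ^ (γ / 2) ≤ 1 :=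
      Real.rpow_le_one (sub_nonneg.mpr hd1) (by linarith) (by linarith)
    nlinarith

/-- The optimal choice `r - 1 = β / (1 - β) * d` in the resolvent estimate. -/
theorem rpow_mul_le_of_resolvent_bound {α β C d r L : ℝ} (hβ : 0 < β) (hβ1 : β < 1)
    (hC : 0 ≤ C) (hd : 0 < d) (hr : r = 1 + β / (1 - β) * d) (hL : 0 ≤ L)
    (h : L ^ α * (r - 1) ^ β ≤ C * r ^ (α + β - 1) * (r - 1 + d)) :
    L ^ (α / (1 - β)) * (β ^ (β / (1 - β)) * (1 - β)) ≤
      C ^ (1 / (1 - β)) * r ^ (α / (1 - β) - 1) * d := by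
  have hb : 0 < 1 - β := by linarith
  have hrpos : 0 < r := by rw [hr]; positivity
  have hdb : d ^ β * d ^ (1 - β) = d := by
    rw [← Real.rpow_add hd, add_sub_cancel, Real.rpow_one]
  have hbb : (1 - β) ^ β * (1 - β) ^ (1 - β) = 1 - β := by
    rw [← Real.rpow_add hb, add_sub_cancel, Real.rpow_one]
  have hkey : L ^ α * (β ^ β * (1 - β) ^ (1 - β)) ≤ C * r ^ (α + β - 1) * d ^ (1 - β) := by
    have h1 : r - 1 = β / (1 - β) * d := by rw [hr]; ring
    have h2 : r - 1 + d = d / (1 - β) := by rw [h1]; field_simp; ring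
    rw [h2, h1, Real.mul_rpow (by positivity) hd.le, Real.div_rpow hβ.le hb.le] at h
    have hc : 0 < d ^ β / (1 - β) := by positivity
    refine le_of_mul_le_mul_right ?_ hc
    have hbβ : (1 - β) ^ β ≠ 0 := (Real.rpow_pos_of_pos hb β).ne'
    calc L ^ α * (β ^ β * (1 - β) ^ (1 - β)) * (d ^ β / (1 - β))
        = L ^ α * (β ^ β / (1 - β) ^ β * d ^ β) := by
          rw [eq_div_of_mul_eq hbβ ((mul_comm _ _).trans hbb)]
          field_simp
      _ ≤ C * r ^ (α + β - 1) * (d / (1 - β)) := h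
      _ = C * r ^ (α + β - 1) * d ^ (1 - β) * (d ^ β / (1 - β)) := by
          nth_rewrite 1 [← hdb]
          ring
  have hpow := Real.rpow_le_rpow (by positivity) hkey (by positivity : 0 ≤ 1 / (1 - β))
  rw [Real.mul_rpow (by positivity) (by positivity), Real.mul_rpow (by positivity) (by positivity),
    Real.mul_rpow (by positivity) (by positivity), Real.mul_rpow (by positivity) (by positivity),
    ← Real.rpow_mul hL, ← Real.rpow_mul hβ.le, ← Real.rpow_mul hb.le, ← Real.rpow_mul hrpos.le,
    ← Real.rpow_mul hd.le, mul_one_div_cancel hb.ne', Real.rpow_one, Real.rpow_one,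
    mul_one_div, mul_one_div, mul_one_div] at hpow
  have hexp : (α + β - 1) / (1 - β) = α / (1 - β) - 1 := by field_simp; ring
  rwa [hexp] at hpow

theorem one_le_mul_rpow_div {β C d : ℝ} (hβ : 0 < β) (hβ1 : β < 1) (hC : 1 ≤ C)
    (hd : 1 ≤ d / (1 - β)) :
    1 ≤ C ^ (1 / (1 - β)) / (β ^ (β / (1 - β)) * (1 - β)) * d := by
  have hb : 0 < 1 - β := by linarith
  have hM : β ^ (β / (1 - β)) ≤ 1 := Real.rpow_le_one hβ.le hβ1.le (by positivity)
  have hMpos : 0 < β ^ (β / (1 - β)) := Real.rpow_pos_of_pos hβ _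
  have hCq : 1 ≤ C ^ (1 / (1 - β)) := Real.one_le_rpow hC (by positivity)
  have h1 : 1 ≤ C ^ (1 / (1 - β)) / β ^ (β / (1 - β)) := (one_le_div hMpos).mpr (hM.trans hCq)
  calc (1 : ℝ) ≤ C ^ (1 / (1 - β)) / β ^ (β / (1 - β)) * (d / (1 - β)) :=
        one_le_mul_of_one_le_of_one_le h1 hd
    _ = _ := by field_simp

theorem eq_one_of_resolvent_bound {e : ℂ} {α β C : ℝ} (hβ1 : β < 1)
    (h : ∀ r : ℝ, 1 < r → ‖e - 1‖ ^ α * (r - 1) ^ β ≤ C * r ^ (α + β - 1) * (r - 1)) :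
    e = 1 := by
  by_contra hne
  have hpos : 0 < ‖e - 1‖ ^ α := Real.rpow_pos_of_pos (norm_pos_iff.mpr (sub_ne_zero.mpr hne)) _
  have ht : Tendsto (fun r : ℝ ↦ C * r ^ (α + β - 1) * (r - 1) ^ (1 - β)) (𝓝[>] 1)
      (𝓝 (C * 1 ^ (α + β - 1) * (1 - 1) ^ (1 - β))) := by
    refine (ContinuousAt.tendsto ?_).mono_left nhdsWithin_le_nhds
    exact (continuousAt_const.mul (Real.continuousAt_rpow_const _ _ (Or.inl one_ne_zero))).mul
      ((continuousAt_id.sub continuousAt_const).rpow_const (Or.inr (by linarith)))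
  rw [sub_self, Real.zero_rpow (by linarith), mul_zero] at ht
  refine hpos.not_ge (ge_of_tendsto ht (eventually_mem_nhdsWithin.mono fun r hr ↦ ?_))
  have hr1 : 0 < r - 1 := sub_pos.mpr hr
  refine le_of_mul_le_mul_right ?_ (Real.rpow_pos_of_pos hr1 β)
  rw [mul_assoc _ ((r - 1) ^ (1 - β)), ← Real.rpow_add hr1, sub_add_cancel, Real.rpow_one]
  exact h r hr

/-- For an `(α,β)`-RK operator with `β < 1` and `α + β > 1`, the spectrum is contained in the
closure of the `(α/(1−β))`-Stolz domain with parameter `σ = 2 C_{α,β}`. -/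
theorem spectrum_subset_closure_stolz
    {X : Type*} [NormedAddCommGroup X] [NormedSpace ℂ X] [CompleteSpace X]
    (T : X →L[ℂ] X) (α β C : ℝ) (hα : 0 ≤ α) (hβ : 0 ≤ β) (hβ1 : β < 1)
    (hsum : 1 < α + β) (hT : IsRK T α β C) :
    spectrum ℂ T ⊆
      closure (stolzDomain (α / (1 - β))
        (2 * (if β = 0 then C
              else C ^ ((1 : ℝ) / (1 - β)) * 2 ^ (α / (1 - β)) /
                (β ^ (β / (1 - β)) * (1 - β))))) := by
  refine Set.Subset.trans (fun z hz ↦ ?_) subset_closure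
  have hC : 1 ≤ C := hT.1
  have hb : 0 < 1 - β := by linarith
  have hγ : 1 < α / (1 - β) := by rw [one_lt_div hb]; linarith
  have hz1 : ‖z‖ ≤ 1 := not_lt.mp fun h ↦ hz (hT.2 z h).1
  obtain ⟨e, he, hze, hne⟩ := exists_norm_eq_one_eq_norm_mul z
  have hL : ∀ r : ℝ, 1 < r →
      ‖r * e - 1‖ ^ α * (r - 1) ^ β ≤ C * r ^ (α + β - 1) * (r - ‖z‖) := fun r hr ↦ by
    have hre : ‖(r : ℂ) * e‖ = r := by
      rw [norm_mul, he, mul_one, Complex.norm_of_nonneg (by linarith)]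
    have hrz : ‖(r : ℂ) * e - z‖ = r - ‖z‖ := by
      nth_rewrite 1 [hze]
      rw [← sub_mul, norm_mul, he, mul_one, ← Complex.ofReal_sub,
        Complex.norm_of_nonneg (by linarith)]
    have := hT.norm_sub_one_rpow_mul_le hz (lam := r * e) (by rwa [hre])
    rwa [hre, hrz] at this
  have hx : ∀ r : ℝ, 1 < r →
      ‖e - 1‖ ^ α * (r - 1) ^ β ≤ C * r ^ (α + β - 1) * (r - ‖z‖) := fun r hr ↦ by
    refine le_trans ?_ (hL r hr)
    have := norm_sub_one_le_norm_ofReal_mul_sub_one he hr.le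
    have : 0 ≤ (r - 1) ^ β := Real.rpow_nonneg (by linarith) _
    gcongr
  rcases hz1.eq_or_lt with hz1 | hz1
  · rw [hz1] at hx
    right
    rw [Set.mem_singleton_iff, hze, hz1, eq_one_of_resolvent_bound hβ1 hx]
    simp
  left
  have hd : 0 < 1 - ‖z‖ := by linarith
  refine ⟨hz1, ?_⟩
  rw [div_lt_iff₀ hd]
  have hnorm : ‖1 - z‖ ^ (α / (1 - β)) =
      ((1 - ‖z‖) ^ 2 + (1 - (1 - ‖z‖)) * ‖e - 1‖ ^ 2) ^ (α / (1 - β) / 2) := by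
    have := norm_ofReal_mul_sub_one_sq he ‖z‖
    rw [← hze] at this
    rw [sub_sub_cancel, ← neg_sq (1 - ‖z‖), neg_sub, ← this, norm_sub_rev, ← Real.rpow_natCast,
      ← Real.rpow_mul (norm_nonneg _)]
    congr 1
    push_cast
    ring
  rw [hnorm]
  have hlt := sq_add_mul_sq_rpow_lt hd (by linarith [norm_nonneg z]) (norm_nonneg (e - 1)) hγ
    (hne.imp (fun h ↦ by linarith) fun h ↦ norm_pos_iff.mpr (sub_ne_zero.mpr h))
  refine hlt.trans_le ?_
  split_ifs with hβ0
  · subst hβ0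
    have hlim : ‖e - 1‖ ^ α ≤ C * (1 - ‖z‖) := by
      have ht : Tendsto (fun r : ℝ ↦ C * r ^ (α + 0 - 1) * (r - ‖z‖)) (𝓝[>] 1)
          (𝓝 (C * 1 ^ (α + 0 - 1) * (1 - ‖z‖))) := by
        refine (ContinuousAt.tendsto ?_).mono_left nhdsWithin_le_nhds
        exact (continuousAt_const.mul (Real.continuousAt_rpow_const _ _ (Or.inl one_ne_zero))).mul
          (continuousAt_id.sub continuousAt_const)
      rw [Real.one_rpow, mul_one] at ht
      refine ge_of_tendsto ht (eventually_mem_nhdsWithin.mono fun r hr ↦ ?_)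
      simpa using hx r hr
    rw [sub_zero, div_one]
    nlinarith
  · have hβ0 : 0 < β := lt_of_le_of_ne hβ (Ne.symm hβ0)
    set γ := α / (1 - β) with hγdef
    set K := C ^ (1 / (1 - β)) / (β ^ (β / (1 - β)) * (1 - β)) with hK
    have hden : 0 < β ^ (β / (1 - β)) * (1 - β) := mul_pos (Real.rpow_pos_of_pos hβ0 _) hb
    have hKd : ∀ d, 1 ≤ d / (1 - β) → 1 ≤ K * d := fun d ↦ one_le_mul_rpow_div hβ0 hβ1 hC
    have hK1 : 1 ≤ K := by
      simpa using hKd 1 (by rw [one_le_div hb]; linarith)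
    have h2 : (1 : ℝ) ≤ 2 ^ γ := Real.one_le_rpow one_le_two (by linarith)
    have hchord : ‖e - 1‖ ^ γ ≤ 2 ^ γ * (K * (1 - ‖z‖)) := by
      obtain ⟨r, hr⟩ : ∃ r, r = 1 + β / (1 - β) * (1 - ‖z‖) := ⟨_, rfl⟩
      have hr1 : 1 < r := by
        rw [hr]
        have : 0 < β / (1 - β) * (1 - ‖z‖) := by positivity
        linarith
      rcases le_or_gt r 2 with hr2 | hr2
      · have hopt := rpow_mul_le_of_resolvent_bound hβ0 hβ1 (zero_le_one.trans hC) hd hr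
          (norm_nonneg _)
          (by simpa using hL r hr1)
        rw [← le_div_iff₀ hden] at hopt
        calc ‖e - 1‖ ^ γ ≤ ‖r * e - 1‖ ^ γ := by
              have := norm_sub_one_le_norm_ofReal_mul_sub_one he hr1.le
              gcongr
          _ ≤ _ := hopt
          _ = r ^ (γ - 1) * (K * (1 - ‖z‖)) := by rw [hK]; ring
          _ ≤ 2 ^ γ * (K * (1 - ‖z‖)) := by
              have : r ^ (γ - 1) ≤ 2 ^ γ :=
                (Real.rpow_le_rpow_of_exponent_le hr1.le (by linarith)).trans
                  (Real.rpow_le_rpow (by linarith) hr2 (by linarith))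
              gcongr
      · have hx2 : ‖e - 1‖ ≤ 2 := by
          refine (norm_sub_le _ _).trans ?_
          rw [he, norm_one]
          norm_num
        have hd1 : 1 ≤ (1 - ‖z‖) / (1 - β) := by
          have h1 : 1 < β * ((1 - ‖z‖) / (1 - β)) := by
            have : β / (1 - β) * (1 - ‖z‖) = β * ((1 - ‖z‖) / (1 - β)) := by ring
            linarith
          have : 0 < (1 - ‖z‖) / (1 - β) := by positivity
          nlinarith
        calc ‖e - 1‖ ^ γ ≤ 2 ^ γ := by gcongr
          _ ≤ 2 ^ γ * (K * (1 - ‖z‖)) := le_mul_of_one_le_right (by positivity) (hKd _ hd1)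
    have hσ : C ^ (1 / (1 - β)) * 2 ^ γ / (β ^ (β / (1 - β)) * (1 - β)) = 2 ^ γ * K := by
      rw [hK]; ring
    rw [hσ]
    nlinarith [one_le_mul_of_one_le_of_one_le h2 hK1]
end

section
/- For γ ≥ 0 and r ∈ (1, 3/2) set I_γ(r) := ∫_{−π}^{π} |r e^{it} − 1|^{−γ} dt. Then: (a) if 0 ≤ γ < 1 there exists M_γ > 0 such that I_γ(r) ≤ M_γ for all r ∈ (1, 3/2); (b) there exists M_1 > 0 such that I_1(r) ≤ M_1 log((r−1)^{−1}) for all r ∈ (1, 3/2); (c) if γ > 1 there exists M_γ > 0 such that I_γ(r) ≤ M_γ (r−1)^{−γ+1} for all r ∈ (1, 3/2). -/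
open Real in
/-- The integral `I_γ(r) = ∫_{−π}^{π} |r e^{it} − 1|^{−γ} dt` for `r ∈ (1, 3/2)`. -/
noncomputable def Iint (γ r : ℝ) : ℝ :=
  ∫ t in (-π)..π, ‖(r : ℂ) * Complex.exp (t * Complex.I) - 1‖ ^ (-γ)

/-- On `[-π, π]` the distance from `r e^{it}` to `1` is comparable to `(r - 1) + |t|`. -/
theorem sub_one_add_abs_le_four_mul_norm {r t : ℝ} (hr : 1 < r) (ht : |t| ≤ Real.pi) :
    (r - 1 + |t|) / 4 ≤ ‖(r : ℂ) * Complex.exp (t * Complex.I) - 1‖ := by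
  have hsq : ‖(r : ℂ) * Complex.exp (t * Complex.I) - 1‖ ^ 2
      = (r - 1) ^ 2 + 2 * r * (1 - Real.cos t) := by
    rw [← Complex.normSq_eq_norm_sq, Complex.normSq_apply]
    simp only [Complex.sub_re, Complex.sub_im, Complex.re_ofReal_mul, Complex.im_ofReal_mul,
      Complex.exp_ofReal_mul_I_re, Complex.exp_ofReal_mul_I_im, Complex.one_re, Complex.one_im]
    linear_combination r ^ 2 * Real.sin_sq_add_cos_sq t
  have hcos : t ^ 2 / 8 ≤ 1 - Real.cos t := by
    have h := Real.cos_le_one_sub_mul_cos_sq ht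
    have hpi : (1 : ℝ) / 8 ≤ 2 / Real.pi ^ 2 := by
      rw [div_le_div_iff₀ (by norm_num) (by positivity)]
      nlinarith [Real.pi_lt_four, Real.pi_pos]
    nlinarith [mul_le_mul_of_nonneg_right hpi (sq_nonneg t)]
  refine le_of_sq_le_sq ?_ (norm_nonneg _)
  rw [hsq]
  have h1 : 2 * 1 * (t ^ 2 / 8) ≤ 2 * r * (1 - Real.cos t) := by
    gcongr
  nlinarith [sq_nonneg (r - 1 - |t|), sq_abs t, sq_nonneg (r - 1), sq_nonneg t]

theorem Iint_le_integral_rpow {γ r : ℝ} (hγ : 0 ≤ γ) (hr : 1 < r) :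
    Iint γ r ≤ 2 * 4 ^ γ * ∫ x in (r - 1)..(r - 1 + Real.pi), x ^ (-γ) := by
  have hpos : ∀ t : ℝ, 0 < (r - 1 + |t|) / 4 := fun t => by
    have := abs_nonneg t
    linarith
  have hmem : ∀ t ∈ Set.Icc (-Real.pi) Real.pi, |t| ≤ Real.pi := fun t ht => abs_le.2 ht
  have hle : -Real.pi ≤ Real.pi := by linarith [Real.pi_pos]
  have hcont : Continuous fun t : ℝ => ((r - 1 + |t|) / 4) ^ (-γ) :=
    Continuous.rpow_const (by fun_prop) fun t => Or.inl (hpos t).ne'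
  have hint : ∀ a b : ℝ, IntervalIntegrable (fun t : ℝ => ((r - 1 + |t|) / 4) ^ (-γ))
      MeasureTheory.volume a b := fun a b => hcont.intervalIntegrable a b
  have hbound : Iint γ r ≤ ∫ t in (-Real.pi)..Real.pi, ((r - 1 + |t|) / 4) ^ (-γ) := by
    refine intervalIntegral.integral_mono_on hle ?_ (hint _ _) fun t ht =>
      Real.rpow_le_rpow_of_nonpos (hpos t)
        (sub_one_add_abs_le_four_mul_norm hr (hmem t ht)) (neg_nonpos.2 hγ)
    refine ContinuousOn.intervalIntegrable_of_Icc hle ?_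
    refine ContinuousOn.rpow_const (by fun_prop) fun t ht => Or.inl ?_
    exact ((hpos t).trans_le (sub_one_add_abs_le_four_mul_norm hr (hmem t ht))).ne'
  have hhalf : ∫ t in (0 : ℝ)..Real.pi, ((r - 1 + |t|) / 4) ^ (-γ)
      = 4 ^ γ * ∫ x in (r - 1)..(r - 1 + Real.pi), x ^ (-γ) := by
    have hshift := intervalIntegral.integral_comp_add_left (a := 0) (b := Real.pi)
      (fun x : ℝ => x ^ (-γ)) (r - 1)
    rw [add_zero] at hshift
    rw [← hshift, ← intervalIntegral.integral_const_mul]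
    refine intervalIntegral.integral_congr fun t ht => ?_
    rw [Set.uIcc_of_le Real.pi_pos.le] at ht
    have h0 : 0 ≤ r - 1 + t := by linarith [ht.1]
    simp only [abs_of_nonneg ht.1]
    rw [Real.div_rpow h0 (by norm_num), Real.rpow_neg (by norm_num : (0 : ℝ) ≤ 4), div_inv_eq_mul,
      mul_comm]
  have hneg : ∫ t in (-Real.pi)..0, ((r - 1 + |t|) / 4) ^ (-γ)
      = ∫ t in (0 : ℝ)..Real.pi, ((r - 1 + |t|) / 4) ^ (-γ) := by
    have h := intervalIntegral.integral_comp_neg (a := 0) (b := Real.pi)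
      (fun t : ℝ => ((r - 1 + |t|) / 4) ^ (-γ))
    simp only [abs_neg, neg_zero] at h
    exact h.symm
  rw [← intervalIntegral.integral_add_adjacent_intervals (hint _ 0) (hint 0 _), hneg, hhalf]
    at hbound
  linarith

theorem integral_rpow_neg_of_ne_one {γ δ : ℝ} (hγ : γ ≠ 1) (hδ : 0 < δ) :
    ∫ x in δ..(δ + Real.pi), x ^ (-γ)
      = ((δ + Real.pi) ^ (-γ + 1) - δ ^ (-γ + 1)) / (-γ + 1) := by
  refine integral_rpow (Or.inr ⟨fun h => hγ (by linarith), ?_⟩)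
  exact Set.notMem_uIcc_of_lt hδ (by linarith [Real.pi_pos])

/-- Bounds for `I_γ(r)`: bounded for `0 ≤ γ < 1`, `O(log((r−1)⁻¹))` for `γ = 1`, and
`O((r−1)^{−γ+1})` for `γ > 1`, uniformly in `r ∈ (1, 3/2)`. -/
theorem Iint_bounds :
    (∀ γ : ℝ, 0 ≤ γ → γ < 1 →
      ∃ M > (0 : ℝ), ∀ r ∈ Set.Ioo (1 : ℝ) (3 / 2), Iint γ r ≤ M) ∧
    (∃ M > (0 : ℝ), ∀ r ∈ Set.Ioo (1 : ℝ) (3 / 2),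
      Iint 1 r ≤ M * Real.log (r - 1)⁻¹) ∧
    (∀ γ : ℝ, 1 < γ →
      ∃ M > (0 : ℝ), ∀ r ∈ Set.Ioo (1 : ℝ) (3 / 2), Iint γ r ≤ M * (r - 1) ^ (-γ + 1)) := by
  refine ⟨fun γ h0 h1 => ⟨2 * 4 ^ γ * (4 ^ (-γ + 1) / (-γ + 1)), ?_, fun r hr => ?_⟩,
    ⟨24, by norm_num, fun r hr => ?_⟩,
    fun γ h1 => ⟨2 * 4 ^ γ * (1 / (γ - 1)), ?_, fun r hr => ?_⟩⟩
  · have : 0 < -γ + 1 := by linarith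
    positivity
  · have hγ : 0 < -γ + 1 := by linarith
    have hδ : 0 < r - 1 := by linarith [hr.1]
    refine (Iint_le_integral_rpow h0 hr.1).trans ?_
    rw [integral_rpow_neg_of_ne_one h1.ne hδ]
    gcongr
    have h4 : (r - 1 + Real.pi) ^ (-γ + 1) ≤ 4 ^ (-γ + 1) :=
      Real.rpow_le_rpow (by positivity) (by linarith [hr.2, Real.pi_lt_d2]) hγ.le
    linarith [Real.rpow_nonneg hδ.le (-γ + 1)]
  · have hδ : 0 < r - 1 := by linarith [hr.1]
    refine (Iint_le_integral_rpow zero_le_one hr.1).trans ?_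
    simp only [Real.rpow_neg_one, Real.rpow_one]
    rw [integral_inv_of_pos hδ (by positivity), Real.log_div (by positivity) hδ.ne', Real.log_inv]
    have h4 : Real.log (r - 1 + Real.pi) ≤ 2 * Real.log 2 := by
      rw [← Real.log_rpow (by norm_num)]
      exact Real.log_le_log (by positivity) (by norm_num; linarith [hr.2, Real.pi_lt_d2])
    have h2 : Real.log (r - 1) ≤ -Real.log 2 := by
      rw [← Real.log_inv]
      exact Real.log_le_log hδ (by norm_num; linarith [hr.2])
    linarith
  · have : 0 < γ - 1 := by linarith
    positivity
  · have hγ : 0 < γ - 1 := by linarith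
    have hδ : 0 < r - 1 := by linarith [hr.1]
    refine (Iint_le_integral_rpow (by linarith) hr.1).trans ?_
    rw [integral_rpow_neg_of_ne_one h1.ne' hδ, mul_assoc (2 * 4 ^ γ), one_div_mul_eq_div,
      neg_add_eq_sub, ← neg_div_neg_eq, neg_sub, neg_sub]
    gcongr
    linarith [Real.rpow_nonneg (by positivity : 0 ≤ r - 1 + Real.pi) (1 - γ)]
end

section
/- For γ ≥ 0 and r ∈ (1, 3/2) set J_γ(r) := ∫_{−π}^{π} |e^{it} − 1| · |r e^{it} − 1|^{−γ} dt. Then: (a) if 0 ≤ γ < 2 there exists N_γ > 0 such that J_γ(r) ≤ N_γ for all r ∈ (1, 3/2); (b) there exists N_2 > 0 such that J_2(r) ≤ N_2 log((r−1)^{−1}) for all r ∈ (1, 3/2); (c) if γ > 2 there exists N_γ > 0 such that J_γ(r) ≤ N_γ (r−1)^{−γ+1} for all r ∈ (1, 3/2). -/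
open Real in
/-- The integral `J_γ(r) = ∫_{−π}^{π} |e^{it} − 1| · |r e^{it} − 1|^{−γ} dt` for `r ∈ (1, 3/2)`. -/
noncomputable def Jint (γ r : ℝ) : ℝ :=
  ∫ t in (-π)..π,
    ‖Complex.exp (t * Complex.I) - 1‖ * ‖(r : ℂ) * Complex.exp (t * Complex.I) - 1‖ ^ (-γ)

theorem norm_real_mul_sub_one_sq {z : ℂ} (hz : ‖z‖ = 1) (r : ℝ) :
    ‖(r : ℂ) * z - 1‖ ^ 2 = (r - 1) ^ 2 + r * ‖z - 1‖ ^ 2 := by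
  have h : z.re * z.re + z.im * z.im = 1 := by
    rw [← Complex.normSq_apply, ← Complex.sq_norm, hz, one_pow]
  simp only [Complex.sq_norm, Complex.normSq_apply, Complex.sub_re, Complex.sub_im,
    Complex.re_ofReal_mul, Complex.im_ofReal_mul, Complex.one_re, Complex.one_im]
  linear_combination (r ^ 2 - r) * h

theorem abs_add_div_pi_le_norm_mul_exp_sub_one {r t : ℝ} (hr : 1 ≤ r) (ht : |t| ≤ Real.pi) :
    (|t| + (r - 1)) / Real.pi ≤ ‖(r : ℂ) * Complex.exp (t * Complex.I) - 1‖ := by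
  have hsq := norm_real_mul_sub_one_sq (Complex.norm_exp_ofReal_mul_I t) r
  have hpi := Real.two_le_pi
  have hs : r - 1 ≤ ‖(r : ℂ) * Complex.exp (t * Complex.I) - 1‖ :=
    le_of_sq_le_sq (by rw [hsq]; nlinarith [sq_nonneg ‖Complex.exp (t * Complex.I) - 1‖])
      (norm_nonneg _)
  have ha : ‖Complex.exp (t * Complex.I) - 1‖ ≤
      ‖(r : ℂ) * Complex.exp (t * Complex.I) - 1‖ :=
    le_of_sq_le_sq (by
      rw [hsq]; nlinarith [sq_nonneg ‖Complex.exp (t * Complex.I) - 1‖, sq_nonneg (r - 1)])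
      (norm_nonneg _)
  have hsin : 2 / Real.pi * |t| ≤ ‖Complex.exp (t * Complex.I) - 1‖ := by
    have h2 : |t / 2| = |t| / 2 := by rw [abs_div, abs_two]
    have h := Real.mul_abs_le_abs_sin (x := t / 2) (by rw [h2]; linarith)
    rw [mul_comm (t : ℂ), Complex.norm_exp_I_mul_ofReal_sub_one, Real.norm_eq_abs, abs_mul,
      abs_two]
    rw [h2] at h
    linarith
  have h3 : (r - 1) / Real.pi ≤ (r - 1) / 2 :=
    div_le_div_of_nonneg_left (by linarith) two_pos hpi
  have h4 : 2 / Real.pi * |t| = 2 * (|t| / Real.pi) := by ring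
  rw [add_div]
  linarith

theorem norm_exp_sub_one_mul_rpow_le {γ r t : ℝ} (hγ : 0 ≤ γ) (hr : 1 < r)
    (ht : |t| ≤ Real.pi) :
    ‖Complex.exp (t * Complex.I) - 1‖ * ‖(r : ℂ) * Complex.exp (t * Complex.I) - 1‖ ^ (-γ) ≤
      Real.pi ^ γ * (|t| + (r - 1)) ^ (1 - γ) := by
  have hu : 0 < |t| + (r - 1) := by linarith [abs_nonneg t]
  have ha : ‖Complex.exp (t * Complex.I) - 1‖ ≤ |t| + (r - 1) := by
    rw [mul_comm (t : ℂ)]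
    exact Real.norm_exp_I_mul_ofReal_sub_one_le.trans (by rw [Real.norm_eq_abs]; linarith)
  calc _ ≤ (|t| + (r - 1)) * ((|t| + (r - 1)) / Real.pi) ^ (-γ) :=
        mul_le_mul ha (Real.rpow_le_rpow_of_nonpos (by positivity)
          (abs_add_div_pi_le_norm_mul_exp_sub_one hr.le ht) (by linarith)) (by positivity) hu.le
    _ = _ := by
      rw [Real.div_rpow hu.le Real.pi_pos.le, Real.rpow_neg Real.pi_pos.le, sub_eq_add_neg 1 γ,
        Real.rpow_add hu, Real.rpow_one, div_inv_eq_mul]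
      ring

theorem integral_comp_abs_neg_self {f : ℝ → ℝ} {a : ℝ} (ha : 0 ≤ a)
    (hf : ContinuousOn f (Set.Icc 0 a)) :
    ∫ t in (-a)..a, f |t| = 2 * ∫ t in (0 : ℝ)..a, f t := by
  have hc : ContinuousOn (fun t => f |t|) (Set.Icc (-a) a) :=
    hf.comp continuous_abs.continuousOn fun t ht => ⟨abs_nonneg t, abs_le.2 ht⟩
  have hpos : ∫ t in (0 : ℝ)..a, f |t| = ∫ t in (0 : ℝ)..a, f t :=
    intervalIntegral.integral_congr fun t ht => by
      rw [Set.uIcc_of_le ha] at ht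
      simp only [abs_of_nonneg ht.1]
  have hneg : ∫ t in (-a)..0, f |t| = ∫ t in (0 : ℝ)..a, f |t| := by
    simpa using (intervalIntegral.integral_comp_neg (a := 0) (b := a) fun t => f |t|).symm
  rw [← intervalIntegral.integral_add_adjacent_intervals (b := 0), hneg, hpos, two_mul]
  · exact (hc.mono (Set.Icc_subset_Icc_right ha)).intervalIntegrable_of_Icc (by linarith)
  · exact (hc.mono (Set.Icc_subset_Icc_left (by linarith))).intervalIntegrable_of_Icc ha

theorem Jint_le_integral_rpow {γ r : ℝ} (hγ : 0 ≤ γ) (hr : 1 < r) :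
    Jint γ r ≤ 2 * Real.pi ^ γ * ∫ u in (r - 1)..(Real.pi + (r - 1)), u ^ (1 - γ) := by
  have hpi := Real.pi_pos
  have hle : -Real.pi ≤ Real.pi := by linarith
  have hcont : ContinuousOn (fun t : ℝ => Real.pi ^ γ * (t + (r - 1)) ^ (1 - γ))
      (Set.Icc 0 Real.pi) :=
    continuousOn_const.mul ((continuousOn_id.add continuousOn_const).rpow_const fun t ht =>
      Or.inl (add_pos_of_nonneg_of_pos ht.1 (sub_pos.2 hr)).ne')
  have hD : ∀ t ∈ Set.Icc (-Real.pi) Real.pi,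
      ‖(r : ℂ) * Complex.exp (t * Complex.I) - 1‖ ≠ 0 := fun t ht =>
    (lt_of_lt_of_le (div_pos (by linarith [abs_nonneg t]) hpi)
      (abs_add_div_pi_le_norm_mul_exp_sub_one hr.le (abs_le.2 ht))).ne'
  calc Jint γ r ≤ ∫ t in (-Real.pi)..Real.pi, Real.pi ^ γ * (|t| + (r - 1)) ^ (1 - γ) := by
        refine intervalIntegral.integral_mono_on hle ?_ ?_ fun t ht =>
          norm_exp_sub_one_mul_rpow_le hγ hr (abs_le.2 ht)
        · refine ContinuousOn.intervalIntegrable_of_Icc hle (ContinuousOn.mul (by fun_prop) ?_)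
          exact ContinuousOn.rpow_const (by fun_prop) fun t ht => Or.inl (hD t ht)
        · exact (hcont.comp continuous_abs.continuousOn fun t ht =>
            ⟨abs_nonneg t, abs_le.2 ht⟩).intervalIntegrable_of_Icc hle
    _ = _ := by
      rw [integral_comp_abs_neg_self hpi.le hcont, intervalIntegral.integral_const_mul,
        intervalIntegral.integral_comp_add_right (fun u : ℝ => u ^ (1 - γ)), zero_add, mul_assoc]

theorem integral_rpow_one_sub {γ a b : ℝ} (hγ : γ ≠ 2) (ha : 0 < a) (hb : 0 < b) :
    ∫ u in a..b, u ^ (1 - γ) = (b ^ (2 - γ) - a ^ (2 - γ)) / (2 - γ) := by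
  rw [integral_rpow (Or.inr ⟨fun h => hγ (by linarith), Set.notMem_uIcc_of_lt ha hb⟩),
    show 1 - γ + 1 = 2 - γ by ring]

theorem Jint_le_of_lt_two {γ r : ℝ} (h0 : 0 ≤ γ) (h2 : γ < 2)
    (hr : r ∈ Set.Ioo (1 : ℝ) (3 / 2)) :
    Jint γ r ≤ 2 * Real.pi ^ γ * ((Real.pi + 1) ^ (2 - γ) / (2 - γ)) := by
  obtain ⟨hr1, hr2⟩ := hr
  have hpi := Real.pi_pos
  have hs : 0 < r - 1 := by linarith
  refine (Jint_le_integral_rpow h0 hr1).trans (mul_le_mul_of_nonneg_left ?_ (by positivity))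
  rw [integral_rpow_one_sub h2.ne hs (by positivity)]
  refine div_le_div_of_nonneg_right ?_ (by linarith)
  have h : (Real.pi + (r - 1)) ^ (2 - γ) ≤ (Real.pi + 1) ^ (2 - γ) :=
    Real.rpow_le_rpow (by positivity) (by linarith) (by linarith)
  linarith [Real.rpow_nonneg hs.le (2 - γ)]

theorem Jint_two_le {r : ℝ} (hr : r ∈ Set.Ioo (1 : ℝ) (3 / 2)) :
    Jint 2 r ≤ 2 * Real.pi ^ (2 : ℝ) * 4 * Real.log (r - 1)⁻¹ := by
  obtain ⟨hr1, hr2⟩ := hr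
  have hpi := Real.pi_pos
  have hs : 0 < r - 1 := by linarith
  rw [mul_assoc _ 4]
  refine (Jint_le_integral_rpow zero_le_two hr1).trans
    (mul_le_mul_of_nonneg_left ?_ (by positivity))
  have hint : ∫ u in (r - 1)..(Real.pi + (r - 1)), u ^ ((1 : ℝ) - 2) =
      Real.log ((Real.pi + (r - 1)) / (r - 1)) := by
    rw [← integral_inv_of_pos hs (by positivity)]
    norm_num [Real.rpow_neg_one]
  have hinv : 2 ≤ (r - 1)⁻¹ := by
    rw [le_inv_comm₀ two_pos hs]
    linarith
  have h8 : (8 : ℝ) ≤ (r - 1)⁻¹ ^ 3 := by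
    calc (8 : ℝ) = 2 ^ 3 := by norm_num
      _ ≤ _ := pow_le_pow_left₀ zero_le_two hinv 3
  rw [hint, show (4 : ℝ) * Real.log (r - 1)⁻¹ = Real.log ((r - 1)⁻¹ ^ 4) by simp]
  refine Real.log_le_log (by positivity) ?_
  rw [div_eq_mul_inv, pow_succ]
  exact mul_le_mul_of_nonneg_right (by linarith [Real.pi_le_four]) (by positivity)

theorem Jint_le_of_two_lt {γ r : ℝ} (h2 : 2 < γ) (hr : r ∈ Set.Ioo (1 : ℝ) (3 / 2)) :
    Jint γ r ≤ 2 * Real.pi ^ γ * (γ - 2)⁻¹ * (r - 1) ^ (-γ + 1) := by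
  obtain ⟨hr1, hr2⟩ := hr
  have hpi := Real.pi_pos
  have hs : 0 < r - 1 := by linarith
  rw [mul_assoc _ (γ - 2)⁻¹]
  refine (Jint_le_integral_rpow (by linarith) hr1).trans
    (mul_le_mul_of_nonneg_left ?_ (by positivity))
  rw [integral_rpow_one_sub h2.ne' hs (by positivity), ← neg_div_neg_eq, neg_sub, neg_sub,
    inv_mul_eq_div]
  refine div_le_div_of_nonneg_right ?_ (by linarith)
  have h : (r - 1) ^ (2 - γ) ≤ (r - 1) ^ (-γ + 1) :=
    Real.rpow_le_rpow_of_exponent_ge hs (by linarith) (by linarith)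
  have h' : 0 ≤ (Real.pi + (r - 1)) ^ (2 - γ) := by positivity
  linarith

/-- Bounds for `J_γ(r)`: bounded for `0 ≤ γ < 2`, `O(log((r−1)⁻¹))` for `γ = 2`, and
`O((r−1)^{−γ+1})` for `γ > 2`, uniformly in `r ∈ (1, 3/2)`. -/
theorem Jint_bounds :
    (∀ γ : ℝ, 0 ≤ γ → γ < 2 →
      ∃ N > (0 : ℝ), ∀ r ∈ Set.Ioo (1 : ℝ) (3 / 2), Jint γ r ≤ N) ∧
    (∃ N > (0 : ℝ), ∀ r ∈ Set.Ioo (1 : ℝ) (3 / 2),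
      Jint 2 r ≤ N * Real.log (r - 1)⁻¹) ∧
    (∀ γ : ℝ, 2 < γ →
      ∃ N > (0 : ℝ), ∀ r ∈ Set.Ioo (1 : ℝ) (3 / 2), Jint γ r ≤ N * (r - 1) ^ (-γ + 1)) := by
  refine ⟨fun γ h0 h2 => ⟨_, ?_, fun r hr => Jint_le_of_lt_two h0 h2 hr⟩,
    ⟨_, ?_, fun r hr => Jint_two_le hr⟩, fun γ h2 => ⟨_, ?_, fun r hr => Jint_le_of_two_lt h2 hr⟩⟩
  · have : 0 < 2 - γ := by linarith
    positivity
  · positivity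
  · have : 0 < γ - 2 := by linarith
    positivity
end

section
/- Let T be an (α,β)-RK operator on a complex Banach space X with α, β ≥ 0, and let k ∈ ℕ ∪ {0} satisfy α(k+1) < 1. Then there exist a constant M > 0 and N ∈ ℕ such that ‖T^n‖ ≤ M n^{k(β−1)+β} for all n ≥ N. -/
open MeasureTheory Set Filter Topology

/-- The resolvent estimate in the variable `z = λ⁻¹`, valid on the whole open unit disc. -/
theorem IsRK.isUnit_and_norm_inverse_one_sub_smul_le
    {X : Type*} [NormedAddCommGroup X] [NormedSpace ℂ X]
    {T : X →L[ℂ] X} {α β C : ℝ} (hT : IsRK T α β C) {z : ℂ} (hz : ‖z‖ < 1) :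
    IsUnit (1 - z • T) ∧
      ‖Ring.inverse (1 - z • T)‖ ≤ C / (‖1 - z‖ ^ α * (1 - ‖z‖) ^ β) := by
  rcases eq_or_ne z 0 with rfl | h0
  · have h1 : ‖(1 : X →L[ℂ] X)‖ ≤ C := ContinuousLinearMap.norm_id_le.trans hT.1
    simpa using h1
  have hρ : 0 < ‖z‖ := norm_pos_iff.2 h0
  have hlam : 1 < ‖z⁻¹‖ := by rw [norm_inv]; exact (one_lt_inv₀ hρ).2 hz
  obtain ⟨hu, hR⟩ := hT.2 z⁻¹ hlam
  have hz' : IsUnit (algebraMap ℂ (X →L[ℂ] X) z) := (IsUnit.mk0 z h0).map _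
  have hfac : 1 - z • T = algebraMap ℂ (X →L[ℂ] X) z * (algebraMap ℂ (X →L[ℂ] X) z⁻¹ - T) := by
    rw [mul_sub, ← map_mul, mul_inv_cancel₀ h0, map_one, ← Algebra.smul_def]
  have hzinv : Ring.inverse (algebraMap ℂ (X →L[ℂ] X) z) = algebraMap ℂ (X →L[ℂ] X) z⁻¹ := by
    rw [← mul_one (Ring.inverse _), Ring.inverse_mul_eq_iff_eq_mul _ _ _ hz', ← map_mul,
      mul_inv_cancel₀ h0, map_one]
  refine ⟨hfac ▸ hz'.mul hu, ?_⟩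
  rw [hfac, Ring.inverse_mul (Or.inl hz'), hzinv, ← Algebra.commutes, ← Algebra.smul_def, norm_smul]
  refine (mul_le_mul_of_nonneg_left hR (norm_nonneg _)).trans_eq ?_
  have h1 : ‖z⁻¹ - 1‖ = ‖1 - z‖ / ‖z‖ := by
    rw [← norm_div]; congr 1; field_simp
  have h2 : ‖z⁻¹‖ - 1 = (1 - ‖z‖) / ‖z‖ := by
    rw [norm_inv]; field_simp
  rw [h1, h2, norm_inv, Real.div_rpow (norm_nonneg _) hρ.le, Real.div_rpow (by linarith) hρ.le,
    Real.inv_rpow hρ.le, Real.rpow_sub hρ, Real.rpow_add hρ, Real.rpow_one]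
  have := Real.rpow_pos_of_pos hρ α
  have := Real.rpow_pos_of_pos hρ β
  field_simp

/-- Cauchy's estimate for the coefficients of `(1 - z a)^{-(k+1)} = ∑ (n+k choose k) a ^ n z ^ n`. -/
theorem norm_pow_le_of_circle_integral
    {A : Type*} [NormedRing A] [NormedAlgebra ℂ A] [CompleteSpace A] (a : A) (k n : ℕ)
    {r : ℝ} (hr : 0 < r) (ha : ∀ z : ℂ, ‖z‖ ≤ r → IsUnit (1 - z • a)) :
    ((n + k).choose k : ℝ) * ‖a ^ n‖ ≤
      ((2 * Real.pi)⁻¹ * ∫ θ in (0 : ℝ)..2 * Real.pi,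
        ‖Ring.inverse (1 - circleMap 0 r θ • a) ^ (k + 1)‖) * r⁻¹ ^ n := by
  set f : ℂ → A := fun z => Ring.inverse (1 - z • a) ^ (k + 1) with hf
  lift r to NNReal using hr.le
  have hr' : 0 < r := by exact_mod_cast hr
  have hd : DifferentiableOn ℂ f (Metric.closedBall 0 r) := by
    intro z hz
    have hu := ha z (by simpa using hz)
    have h1 : DifferentiableAt ℂ (fun z : ℂ => 1 - z • a) z := by fun_prop
    exact (((differentiableAt_inverse (𝕜 := ℂ) hu).comp z h1).pow _).differentiableWithinAt
  have hp := (hd.hasFPowerSeriesOnBall hr').hasFPowerSeriesAt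
  set q : FormalMultilinearSeries ℂ ℂ A := fun n =>
    ContinuousMultilinearMap.mkPiRing ℂ (Fin n) (((n + k).choose k : A) * a ^ n) with hq
  have hcoeff : ∀ n, q.coeff n = ((n + k).choose k : A) * a ^ n := fun n => by
    simp [FormalMultilinearSeries.coeff, hq]
  have hqs : HasFPowerSeriesAt f q 0 := by
    rw [hasFPowerSeriesAt_iff]
    have hev : ∀ᶠ z : ℂ in 𝓝 0, ‖z • a‖ < 1 := by
      have : ContinuousAt (fun z : ℂ => ‖z • a‖) 0 := by fun_prop
      exact this.eventually_lt continuousAt_const (by simp)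
    filter_upwards [hev] with z hz
    simpa [hcoeff, hf, smul_pow] using hasSum_choose_mul_geometric_of_norm_lt_one' k hz
  have heq := hp.eq_formalMultilinearSeries hqs
  have hle := norm_cauchyPowerSeries_le f 0 r n
  rw [heq, FormalMultilinearSeries.norm_apply_eq_norm_coef, hcoeff, ← nsmul_eq_mul,
    ← Nat.cast_smul_eq_nsmul ℂ, norm_smul, Complex.norm_natCast, abs_of_pos hr] at hle
  exact hle

theorem abs_le_pi_mul_norm_one_sub_circleMap {r θ : ℝ} (hr : 0 ≤ r) (hr1 : r ≤ 1)
    (hθ : |θ| ≤ Real.pi) : |θ| ≤ Real.pi * ‖1 - circleMap 0 r θ‖ := by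
  set e : ℂ := Complex.exp (Complex.I * θ) with he
  have hz : circleMap 0 r θ = r * e := by simp [circleMap, he, mul_comm]
  have hne : ‖e‖ = 1 := by rw [he, mul_comm]; exact Complex.norm_exp_ofReal_mul_I θ
  have h1 : ‖e - 1‖ ≤ 2 * ‖1 - circleMap 0 r θ‖ := by
    have h2 : ‖e - r * e‖ = 1 - r := by
      rw [← one_sub_mul, norm_mul, hne, mul_one, ← Complex.ofReal_one, ← Complex.ofReal_sub,
        Complex.norm_real, Real.norm_of_nonneg (by linarith)]
    have h3 : 1 - r ≤ ‖1 - r * e‖ := by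
      have := norm_sub_norm_le (1 : ℂ) (r * e)
      simpa [hne, abs_of_nonneg hr] using this
    have h4 := norm_sub_le_norm_sub_add_norm_sub e (r * e) 1
    rw [norm_sub_rev (r * e : ℂ) 1] at h4
    rw [hz]; linarith
  have h5 : 2 / Real.pi * |θ / 2| ≤ |Real.sin (θ / 2)| :=
    Real.mul_abs_le_abs_sin (by rw [abs_div, abs_two]; linarith)
  rw [he, Complex.norm_exp_I_mul_ofReal_sub_one, norm_mul, Real.norm_eq_abs, Real.norm_eq_abs,
    abs_two] at h1
  rw [abs_div, abs_two] at h5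
  have hpi := Real.pi_pos
  have h6 : |θ| / Real.pi ≤ ‖1 - circleMap 0 r θ‖ := by
    have : 2 / Real.pi * (|θ| / 2) = |θ| / Real.pi := by ring
    linarith
  rw [div_le_iff₀ hpi] at h6
  linarith

theorem intervalIntegrable_abs_rpow {s : ℝ} (hs : -1 < s) (b : ℝ) :
    IntervalIntegrable (fun x : ℝ => |x| ^ s) volume (-b) b := by
  refine intervalIntegrable_of_even (fun x => by rw [abs_neg]) fun t ht => ?_
  refine (intervalIntegral.intervalIntegrable_rpow' (a := 0) (b := t) hs).congr fun x hx => ?_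
  rw [uIoc_of_le ht.le] at hx
  simp only [abs_of_pos hx.1]

/-- The circle means of `‖(1 - z T)⁻¹ ^ (k+1)‖` grow at most like `(1 - r)^(-β(k+1))`. -/
theorem IsRK.integral_norm_inverse_pow_le
    {X : Type*} [NormedAddCommGroup X] [NormedSpace ℂ X]
    {T : X →L[ℂ] X} {α β C : ℝ} (hα : 0 ≤ α) (hT : IsRK T α β C)
    (k : ℕ) (hk : α * (k + 1) < 1) {r : ℝ} (hr : 0 ≤ r) (hr1 : r < 1) :
    ∫ θ in (0 : ℝ)..2 * Real.pi, ‖Ring.inverse (1 - circleMap 0 r θ • T) ^ (k + 1)‖ ≤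
      (C * Real.pi ^ α / (1 - r) ^ β) ^ (k + 1) *
        ∫ θ in -Real.pi..Real.pi, |θ| ^ (-(α * (k + 1))) := by
  have hpi := Real.pi_pos
  have hper : Function.Periodic
      (fun θ : ℝ => ‖Ring.inverse (1 - circleMap 0 r θ • T) ^ (k + 1)‖) (2 * Real.pi) :=
    fun θ => by simp only [periodic_circleMap 0 r θ]
  have hshift := hper.intervalIntegral_add_eq 0 (-Real.pi)
  rw [zero_add, show -Real.pi + 2 * Real.pi = Real.pi by ring] at hshift
  rw [hshift, ← intervalIntegral.integral_const_mul]
  refine (Real.le_norm_self _).trans (intervalIntegral.norm_integral_le_of_norm_le (by linarith) ?_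
    ((intervalIntegrable_abs_rpow (by linarith) _).const_mul _))
  filter_upwards [Measure.ae_ne volume (0 : ℝ)] with θ hθ0 hθ
  have hθpos : 0 < |θ| := abs_pos.2 hθ0
  have hnorm : ‖circleMap 0 r θ‖ = r := by rw [norm_circleMap_zero, abs_of_nonneg hr]
  have hR := (hT.isUnit_and_norm_inverse_one_sub_smul_le (z := circleMap 0 r θ)
    (by rwa [hnorm])).2
  have hdist := abs_le_pi_mul_norm_one_sub_circleMap hr hr1.le (abs_le.2 ⟨hθ.1.le, hθ.2⟩)
  have hC : 0 ≤ C := zero_le_one.trans hT.1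
  have hβr : 0 < (1 - r) ^ β := Real.rpow_pos_of_pos (by linarith) β
  have hθα : 0 < |θ| ^ α := Real.rpow_pos_of_pos hθpos α
  have hpow : |θ| ^ α ≤ Real.pi ^ α * ‖1 - circleMap 0 r θ‖ ^ α := by
    rw [← Real.mul_rpow hpi.le (norm_nonneg _)]
    exact Real.rpow_le_rpow hθpos.le hdist hα
  have hπα : 0 < Real.pi ^ α := Real.rpow_pos_of_pos hpi α
  have hzα : 0 < ‖1 - circleMap 0 r θ‖ ^ α := pos_of_mul_pos_right (hθα.trans_le hpow) hπα.le
  have hle : ‖Ring.inverse (1 - circleMap 0 r θ • T)‖ ≤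
      C * Real.pi ^ α / (1 - r) ^ β * (|θ| ^ α)⁻¹ := by
    refine hR.trans ?_
    rw [hnorm, ← div_eq_mul_inv, div_div, div_le_div_iff₀ (by positivity) (by positivity)]
    calc C * ((1 - r) ^ β * |θ| ^ α)
        ≤ C * ((1 - r) ^ β * (Real.pi ^ α * ‖1 - circleMap 0 r θ‖ ^ α)) := by gcongr
      _ = _ := by ring
  have hexp : |θ| ^ (-(α * (k + 1))) = ((|θ| ^ α)⁻¹) ^ (k + 1) := by
    rw [Real.rpow_neg hθpos.le, Real.rpow_mul hθpos.le, inv_pow, ← Real.rpow_natCast]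
    push_cast; rfl
  rw [norm_norm, hexp, ← mul_pow]
  exact (norm_pow_le' _ k.succ_pos).trans (pow_le_pow_left₀ (norm_nonneg _) hle _)

/-- Power norm estimate for an `(α,β)`-RK operator when `α(k+1) < 1`:
`‖T^n‖ ≤ M n^(k(β−1)+β)` for all sufficiently large `n`. -/
theorem power_norm_bound_of_lt_one
    {X : Type*} [NormedAddCommGroup X] [NormedSpace ℂ X] [CompleteSpace X]
    (T : X →L[ℂ] X) (α β C : ℝ) (hα : 0 ≤ α) (hβ : 0 ≤ β) (hT : IsRK T α β C)
    (k : ℕ) (hk : α * (k + 1) < 1) :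
    ∃ M > (0 : ℝ), ∃ N : ℕ, ∀ n : ℕ, N ≤ n →
      ‖T ^ n‖ ≤ M * (n : ℝ) ^ ((k : ℝ) * (β - 1) + β) := by
  have hpi := Real.pi_pos
  have hC : 0 ≤ C := zero_le_one.trans hT.1
  set J : ℝ := ∫ θ in -Real.pi..Real.pi, |θ| ^ (-(α * (k + 1))) with hJ
  have hJ0 : 0 ≤ J :=
    intervalIntegral.integral_nonneg (by linarith) fun θ _ => Real.rpow_nonneg (abs_nonneg θ) _
  set K : ℝ := (2 * Real.pi)⁻¹ * ((C * Real.pi ^ α * 2 ^ β) ^ (k + 1) * J) * Real.exp 1 with hK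
  have hK0 : 0 ≤ K := by positivity
  refine ⟨k.factorial * K + 1, by positivity, 1, fun n hn => ?_⟩
  have hn0 : (0 : ℝ) < n := by exact_mod_cast hn
  have hn1 : (1 : ℝ) ≤ n := by exact_mod_cast hn
  set r : ℝ := n / (n + 1) with hr
  have hr0 : 0 < r := by positivity
  have hr1 : r < 1 := by rw [hr, div_lt_one (by positivity)]; linarith
  have hcoef := norm_pow_le_of_circle_integral T k n hr0 fun z hz =>
    (hT.isUnit_and_norm_inverse_one_sub_smul_le (hz.trans_lt hr1)).1
  have hint := hT.integral_norm_inverse_pow_le hα k hk hr0.le hr1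
  have hexp : r⁻¹ ^ n ≤ Real.exp 1 := by
    have : r⁻¹ = 1 + (n : ℝ)⁻¹ := by rw [hr]; field_simp
    rw [this]; exact Real.one_add_inv_pow_le_exp
  have hbase : C * Real.pi ^ α / (1 - r) ^ β ≤ C * Real.pi ^ α * 2 ^ β * (n : ℝ) ^ β := by
    have h1 : 1 - r = ((n : ℝ) + 1)⁻¹ := by rw [hr]; field_simp; ring
    rw [h1, Real.inv_rpow (by positivity), div_inv_eq_mul, mul_assoc (C * Real.pi ^ α),
      ← Real.mul_rpow two_pos.le hn0.le]
    gcongr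
    linarith
  have hbase0 : 0 ≤ C * Real.pi ^ α / (1 - r) ^ β := by
    have : 0 < (1 - r) ^ β := Real.rpow_pos_of_pos (by linarith) β
    positivity
  have hmain : ((n + k).choose k : ℝ) * ‖T ^ n‖ ≤ K * ((n : ℝ) ^ β) ^ (k + 1) := by
    calc ((n + k).choose k : ℝ) * ‖T ^ n‖
        ≤ ((2 * Real.pi)⁻¹ * ((C * Real.pi ^ α / (1 - r) ^ β) ^ (k + 1) * J)) * r⁻¹ ^ n :=
          hcoef.trans (by gcongr)
      _ ≤ ((2 * Real.pi)⁻¹ * ((C * Real.pi ^ α * 2 ^ β * (n : ℝ) ^ β) ^ (k + 1) * J)) *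
          Real.exp 1 := by gcongr
      _ = K * ((n : ℝ) ^ β) ^ (k + 1) := by rw [mul_pow _ ((n : ℝ) ^ β), hK]; ring
  have hchoose : (n : ℝ) ^ k ≤ k.factorial * (n + k).choose k := by
    rw [← Nat.cast_mul, ← Nat.ascFactorial_eq_factorial_mul_choose]
    exact_mod_cast (Nat.pow_le_pow_left n.le_succ k).trans
      (Nat.pow_succ_le_ascFactorial (n + 1) k)
  have hpow : (n : ℝ) ^ k * (n : ℝ) ^ ((k : ℝ) * (β - 1) + β) = ((n : ℝ) ^ β) ^ (k + 1) := by
    rw [← Real.rpow_natCast, ← Real.rpow_natCast, ← Real.rpow_mul hn0.le, ← Real.rpow_add hn0]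
    congr 1
    push_cast
    ring
  have hnk : (0 : ℝ) < (n : ℝ) ^ k := by positivity
  refine le_of_mul_le_mul_left ?_ hnk
  calc (n : ℝ) ^ k * ‖T ^ n‖
      ≤ k.factorial * (n + k).choose k * ‖T ^ n‖ := by gcongr
    _ = k.factorial * ((n + k).choose k * ‖T ^ n‖) := by ring
    _ ≤ k.factorial * (K * ((n : ℝ) ^ β) ^ (k + 1)) := by gcongr
    _ ≤ (k.factorial * K + 1) * ((n : ℝ) ^ β) ^ (k + 1) := by
        have : 0 ≤ ((n : ℝ) ^ β) ^ (k + 1) := by positivity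
        linarith
    _ = (n : ℝ) ^ k * ((k.factorial * K + 1) * (n : ℝ) ^ ((k : ℝ) * (β - 1) + β)) := by
        rw [← hpow]; ring
end

section
/- Let T be an (α,β)-RK operator on a complex Banach space X with α, β ≥ 0, and let k ∈ ℕ ∪ {0} satisfy α(k+1) = 1. Then there exist a constant M > 0 and N ∈ ℕ such that ‖T^n‖ ≤ M n^{k(β−1)+β} log(n) for all n ≥ N. -/
open scoped Real Topology NNReal

/-- The power series at the origin with coefficients `(n + k).choose k • a ^ n`. -/
noncomputable def choosePowSeries {A : Type*} [NormedRing A] [NormedAlgebra ℂ A] (a : A) (k : ℕ) :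
    FormalMultilinearSeries ℂ ℂ A :=
  fun n => ContinuousMultilinearMap.mkPiRing ℂ (Fin n) ((n + k).choose k • a ^ n)

theorem coeff_choosePowSeries {A : Type*} [NormedRing A] [NormedAlgebra ℂ A] (a : A) (k n : ℕ) :
    (choosePowSeries a k).coeff n = (n + k).choose k • a ^ n := by
  simp [FormalMultilinearSeries.coeff, choosePowSeries]

/-- The function `z ↦ (1 - z a)⁻¹ ^ (k + 1)` has Taylor coefficients `(n + k).choose k • a ^ n`
at the origin. -/
theorem hasFPowerSeriesAt_inverse_one_sub_smul_pow {A : Type*} [NormedRing A] [NormedAlgebra ℂ A]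
    [CompleteSpace A] (a : A) (k : ℕ) :
    HasFPowerSeriesAt (fun z : ℂ => Ring.inverse (1 - z • a) ^ (k + 1)) (choosePowSeries a k) 0 := by
  rw [hasFPowerSeriesAt_iff]
  have hlim : Filter.Tendsto (fun z : ℂ => ‖z • a‖) (𝓝 0) (𝓝 0) := by
    have : Continuous fun z : ℂ => ‖z • a‖ := by fun_prop
    simpa using this.tendsto 0
  filter_upwards [hlim.eventually (gt_mem_nhds one_pos)] with z hz
  rw [zero_add]
  convert! hasSum_choose_mul_geometric_of_norm_lt_one' k hz using 2 with n
  rw [coeff_choosePowSeries, smul_pow, mul_smul_comm, nsmul_eq_mul]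

/-- Cauchy's estimate for the powers of `a` through an integral mean of `(1 - z a)⁻¹ ^ (k + 1)`. -/
theorem choose_mul_norm_pow_le_circle_integral {A : Type*} [NormedRing A] [NormedAlgebra ℂ A]
    [CompleteSpace A] (a : A) (ha : ∀ z : ℂ, ‖z‖ < 1 → IsUnit (1 - z • a)) (k n : ℕ)
    {r : ℝ} (hr0 : 0 < r) (hr1 : r < 1) :
    (n + k).choose k * ‖a ^ n‖ ≤
      ((2 * π)⁻¹ * ∫ θ in (0)..2 * π, ‖Ring.inverse (1 - circleMap 0 r θ • a) ^ (k + 1)‖) *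
        |r|⁻¹ ^ n := by
  lift r to ℝ≥0 using hr0.le
  have hd : DifferentiableOn ℂ (fun z : ℂ => Ring.inverse (1 - z • a) ^ (k + 1))
      (Metric.closedBall 0 r) := by
    intro z hz
    rw [mem_closedBall_zero_iff] at hz
    have h1 : DifferentiableAt ℂ (fun z : ℂ => Ring.inverse (1 - z • a)) z :=
      DifferentiableAt.comp (f := fun z : ℂ => 1 - z • a) z
        (differentiableAt_inverse (ha z (hz.trans_lt hr1))) (by fun_prop)
    exact (h1.pow _).differentiableWithinAt
  have h1 := (hd.hasFPowerSeriesOnBall (by exact_mod_cast hr0)).hasFPowerSeriesAt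
  have h2 := h1.eq_formalMultilinearSeries (hasFPowerSeriesAt_inverse_one_sub_smul_pow a k)
  have h3 := norm_cauchyPowerSeries_le (fun z : ℂ => Ring.inverse (1 - z • a) ^ (k + 1)) 0 r n
  rw [h2, FormalMultilinearSeries.norm_apply_eq_norm_coef, coeff_choosePowSeries, ← Nat.cast_smul_eq_nsmul ℂ, norm_smul,
    Complex.norm_natCast] at h3
  exact h3

theorem IsRK.isUnit_one_sub_smul {X : Type*} [NormedAddCommGroup X] [NormedSpace ℂ X]
    {T : X →L[ℂ] X} {α β C : ℝ} (hT : IsRK T α β C) {z : ℂ} (hz : ‖z‖ < 1) :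
    IsUnit (1 - z • T) := by
  rcases eq_or_ne z 0 with rfl | hz0
  · simp
  have h := (hT.2 z⁻¹ (by rw [norm_inv]; exact (one_lt_inv₀ (norm_pos_iff.2 hz0)).2 hz)).1
  have h2 := h.smul (Units.mk0 z hz0)
  rwa [smul_sub, Units.smul_mk0, Units.smul_mk0, Algebra.algebraMap_eq_smul_one, smul_smul,
    mul_inv_cancel₀ hz0, one_smul] at h2

theorem IsRK.norm_inverse_one_sub_smul_le {X : Type*} [NormedAddCommGroup X] [NormedSpace ℂ X]
    {T : X →L[ℂ] X} {α β C : ℝ} (hT : IsRK T α β C) {z : ℂ} (hz0 : z ≠ 0) (hz : ‖z‖ < 1) :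
    ‖Ring.inverse (1 - z • T)‖ ≤ C / (‖1 - z‖ ^ α * (1 - ‖z‖) ^ β) := by
  have hp : 0 < ‖z‖ := norm_pos_iff.2 hz0
  have h := (hT.2 z⁻¹ (by rw [norm_inv]; exact (one_lt_inv₀ hp).2 hz)).2
  have e := spectrum.units_smul_resolvent_self (r := Units.mk0 z⁻¹ (inv_ne_zero hz0)) (a := T)
  have e1 : Ring.inverse (1 - z • T) = z⁻¹ • Ring.inverse (algebraMap ℂ (X →L[ℂ] X) z⁻¹ - T) := by
    simpa [resolvent, Units.smul_def] using e.symm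
  have hz1 : ‖z⁻¹ - 1‖ = ‖1 - z‖ * ‖z‖⁻¹ := by
    rw [← norm_inv, ← norm_mul, sub_mul, mul_inv_cancel₀ hz0, one_mul]
  have hz2 : ‖z‖⁻¹ - 1 = (1 - ‖z‖) * ‖z‖⁻¹ := by field_simp
  have hi : 0 < ‖z‖⁻¹ := inv_pos.2 hp
  have h1z : 0 < 1 - ‖z‖ := by linarith
  have h1z' : 0 < ‖1 - z‖ := norm_pos_iff.2 fun h0 => by
    rw [← sub_eq_zero.1 h0, norm_one] at hz; exact lt_irrefl _ hz
  rw [e1, norm_smul, norm_inv]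
  refine (mul_le_mul_of_nonneg_left h hi.le).trans_eq ?_
  rw [hz1, norm_inv, hz2, Real.mul_rpow h1z'.le hi.le, Real.mul_rpow h1z.le hi.le,
    Real.rpow_sub hi, Real.rpow_add hi, Real.rpow_one]
  have := Real.rpow_pos_of_pos hi α
  have := Real.rpow_pos_of_pos hi β
  have := Real.rpow_pos_of_pos h1z β
  have := Real.rpow_pos_of_pos h1z' α
  generalize ‖z‖⁻¹ ^ α = p at *
  generalize ‖z‖⁻¹ ^ β = q at *
  field_simp

theorem inv_norm_one_sub_circleMap_le_of_le_pi {r θ : ℝ} (hr : 1 / 2 ≤ r) (hr1 : r < 1)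
    (h0 : 0 ≤ θ) (h1 : θ ≤ π) : ‖1 - circleMap 0 r θ‖⁻¹ ≤ 4 / (1 - r + θ) := by
  have hpos : 0 < 1 - r + θ := by linarith
  have hsq : ‖1 - circleMap 0 r θ‖ ^ 2 = (1 - r) ^ 2 + 4 * r * Real.sin (θ / 2) ^ 2 := by
    have hc : Real.cos θ = 1 - 2 * Real.sin (θ / 2) ^ 2 := by
      have := Real.cos_two_mul' (θ / 2)
      rw [mul_div_cancel₀ _ two_ne_zero] at this
      have := Real.sin_sq_add_cos_sq (θ / 2)
      linarith
    have hs := Real.sin_sq_add_cos_sq θ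
    rw [← Complex.normSq_eq_norm_sq, Complex.normSq_apply, circleMap]
    simp only [Complex.exp_mul_I, ← Complex.ofReal_cos, ← Complex.ofReal_sin, zero_add,
      Complex.sub_re, Complex.sub_im, Complex.one_re, Complex.one_im, Complex.re_ofReal_mul,
      Complex.im_ofReal_mul, Complex.add_re, Complex.add_im, Complex.ofReal_re, Complex.ofReal_im,
      Complex.mul_I_re, Complex.mul_I_im]
    linear_combination r ^ 2 * hs - 2 * r * hc
  have hsin : θ / 4 ≤ Real.sin (θ / 2) := by
    refine le_trans ?_ (Real.mul_le_sin (by linarith) (by linarith))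
    rw [div_mul_eq_mul_div, div_le_div_iff₀ (by norm_num) Real.pi_pos]
    nlinarith [Real.pi_lt_four]
  have hge : (1 - r + θ) / 4 ≤ ‖1 - circleMap 0 r θ‖ := by
    refine abs_le_of_sq_le_sq' ?_ (norm_nonneg _) |>.2
    rw [hsq]
    have : (θ / 4) ^ 2 ≤ Real.sin (θ / 2) ^ 2 := by gcongr
    nlinarith [sq_nonneg (1 - r - θ)]
  calc _ ≤ ((1 - r + θ) / 4)⁻¹ := by gcongr
    _ = _ := inv_div _ _

theorem inv_norm_one_sub_circleMap_le {r θ : ℝ} (hr : 1 / 2 ≤ r) (hr1 : r < 1)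
    (h0 : 0 ≤ θ) (h1 : θ ≤ 2 * π) :
    ‖1 - circleMap 0 r θ‖⁻¹ ≤ 4 / (1 - r + θ) + 4 / (1 - r + (2 * π - θ)) := by
  have p1 : 0 ≤ 4 / (1 - r + θ) := div_nonneg (by norm_num) (by linarith)
  have p2 : 0 ≤ 4 / (1 - r + (2 * π - θ)) := div_nonneg (by norm_num) (by linarith)
  rcases le_total θ π with h | h
  · linarith [inv_norm_one_sub_circleMap_le_of_le_pi hr hr1 h0 h]
  · have h2 := inv_norm_one_sub_circleMap_le_of_le_pi hr hr1 (θ := 2 * π - θ)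
      (by linarith) (by linarith)
    have e : ‖1 - circleMap 0 r (2 * π - θ)‖ = ‖1 - circleMap 0 r θ‖ := by
      rw [← Complex.norm_conj (1 - circleMap 0 r θ)]
      congr 1
      have h3 : ((2 * π - θ : ℝ) : ℂ) * Complex.I = θ * -Complex.I + 2 * π * Complex.I := by
        push_cast
        ring
      simp only [circleMap, zero_add, map_sub, map_one, map_mul, Complex.conj_ofReal,
        ← Complex.exp_conj, Complex.conj_I]
      rw [h3, Complex.exp_periodic]
    rw [e] at h2
    linarith

theorem integral_inv_add_inv_reflect {δ : ℝ} (hδ : 0 < δ) :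
    IntervalIntegrable (fun θ => 4 / (δ + θ) + 4 / (δ + (2 * π - θ))) MeasureTheory.volume 0
      (2 * π) ∧
    ∫ θ in (0)..2 * π, (4 / (δ + θ) + 4 / (δ + (2 * π - θ))) =
      8 * (Real.log (δ + 2 * π) - Real.log δ) := by
  have hpi := Real.pi_pos
  have hint : IntervalIntegrable (fun θ => 4 / (δ + θ) + 4 / (δ + (2 * π - θ)))
      MeasureTheory.volume 0 (2 * π) := by
    apply ContinuousOn.intervalIntegrable
    rw [Set.uIcc_of_le (by positivity)]
    refine ContinuousOn.add ?_ ?_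
    · exact continuousOn_const.div (by fun_prop) fun θ hθ => by linarith [hθ.1]
    · exact continuousOn_const.div (by fun_prop) fun θ hθ => by linarith [hθ.2]
  refine ⟨hint, ?_⟩
  rw [intervalIntegral.integral_eq_sub_of_hasDerivAt
    (f := fun θ => 4 * Real.log (δ + θ) - 4 * Real.log (δ + (2 * π - θ))) ?_ hint]
  · simp only [sub_self, add_zero, sub_zero]; ring
  · intro θ hθ
    rw [Set.uIcc_of_le (by positivity)] at hθ
    have d1 := ((((hasDerivAt_id θ).const_add δ).log
      (by simp only [id]; linarith [hθ.1])).const_mul 4)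
    have d2 := (((((hasDerivAt_id θ).const_sub (2 * π)).const_add δ).log
      (by simp only [id]; linarith [hθ.2])).const_mul 4)
    refine (d1.sub d2).congr_deriv ?_
    simp only [id]
    ring

theorem IsRK.choose_mul_norm_pow_le {X : Type*} [NormedAddCommGroup X] [NormedSpace ℂ X]
    [CompleteSpace X] {T : X →L[ℂ] X} {α β C : ℝ} (hT : IsRK T α β C)
    {k : ℕ} (hk : α * (k + 1) = 1) (n : ℕ) {r : ℝ} (hr : 1 / 2 ≤ r) (hr1 : r < 1) :
    (n + k).choose k * ‖T ^ n‖ ≤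
      C ^ (k + 1) / (1 - r) ^ (β * (k + 1)) *
        (8 * (Real.log (1 - r + 2 * π) - Real.log (1 - r))) * r⁻¹ ^ n := by
  have hr0 : 0 < r := by linarith
  have h1r : 0 < 1 - r := by linarith
  have hC : 0 < C := one_pos.trans_le hT.1
  have hnorm (θ : ℝ) : ‖circleMap 0 r θ‖ = r := by simp [abs_of_pos hr0]
  have hpos : 0 < (1 - r) ^ (β * (k + 1)) := Real.rpow_pos_of_pos h1r _
  obtain ⟨hint, hval⟩ := integral_inv_add_inv_reflect h1r
  have hcont : Continuous fun θ => ‖Ring.inverse (1 - circleMap 0 r θ • T) ^ (k + 1)‖ := by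
    refine (Continuous.pow ?_ _).norm
    rw [continuous_iff_continuousAt]
    intro θ
    have := (differentiableAt_inverse (𝕜 := ℂ) (hT.isUnit_one_sub_smul
      ((hnorm θ).trans_lt hr1))).continuousAt
    exact ContinuousAt.comp (f := fun θ => 1 - circleMap 0 r θ • T) this
      (by have := continuous_circleMap 0 r; fun_prop)
  have hbound : ∫ θ in (0)..2 * π, ‖Ring.inverse (1 - circleMap 0 r θ • T) ^ (k + 1)‖ ≤
      C ^ (k + 1) / (1 - r) ^ (β * (k + 1)) *
        (8 * (Real.log (1 - r + 2 * π) - Real.log (1 - r))) := by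
    rw [← hval, ← intervalIntegral.integral_const_mul]
    refine intervalIntegral.integral_mono_on (by positivity) (hcont.intervalIntegrable _ _)
      (hint.const_mul _) fun θ hθ => ?_
    have h := hT.norm_inverse_one_sub_smul_le (z := circleMap 0 r θ)
      (norm_pos_iff.1 (by rwa [hnorm])) (by rwa [hnorm])
    rw [hnorm] at h
    calc _ ≤ ‖Ring.inverse (1 - circleMap 0 r θ • T)‖ ^ (k + 1) := norm_pow_le' _ k.succ_pos
      _ ≤ (C / (‖1 - circleMap 0 r θ‖ ^ α * (1 - r) ^ β)) ^ (k + 1) := by gcongr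
      _ = C ^ (k + 1) / (1 - r) ^ (β * (k + 1)) * ‖1 - circleMap 0 r θ‖⁻¹ := by
        rw [div_pow, mul_pow, ← Real.rpow_natCast (_ ^ α), ← Real.rpow_natCast (_ ^ β),
          ← Real.rpow_mul (norm_nonneg _), ← Real.rpow_mul h1r.le]
        push_cast
        rw [hk, Real.rpow_one]
        ring
      _ ≤ _ := by
        gcongr
        exact inv_norm_one_sub_circleMap_le hr hr1 hθ.1 hθ.2
  have h := choose_mul_norm_pow_le_circle_integral T (fun z hz => hT.isUnit_one_sub_smul hz) k n
    hr0 hr1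
  rw [abs_of_pos hr0] at h
  refine h.trans ?_
  refine mul_le_mul_of_nonneg_right (le_trans ?_ hbound) (by positivity)
  refine mul_le_of_le_one_left ?_ (inv_le_one_of_one_le₀ (by linarith [Real.pi_gt_three]))
  exact intervalIntegral.integral_nonneg (by positivity) fun _ _ => norm_nonneg _

/-- Power norm estimate for an `(α,β)`-RK operator when `α(k+1) = 1`:
`‖T^n‖ ≤ M n^(k(β−1)+β) log n` for all sufficiently large `n`. -/
theorem power_norm_bound_of_eq_one
    {X : Type*} [NormedAddCommGroup X] [NormedSpace ℂ X] [CompleteSpace X]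
    (T : X →L[ℂ] X) (α β C : ℝ) (hα : 0 ≤ α) (hβ : 0 ≤ β) (hT : IsRK T α β C)
    (k : ℕ) (hk : α * (k + 1) = 1) :
    ∃ M > (0 : ℝ), ∃ N : ℕ, ∀ n : ℕ, N ≤ n →
      ‖T ^ n‖ ≤ M * (n : ℝ) ^ ((k : ℝ) * (β - 1) + β) * Real.log n := by
  have hC : 0 < C := one_pos.trans_le hT.1
  refine ⟨k.factorial * (C ^ (k + 1) * 32 * Real.exp 2), by positivity, 2, fun n hn => ?_⟩
  have hn2 : (2 : ℝ) ≤ n := by exact_mod_cast hn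
  have hn0 : (0 : ℝ) < n := by linarith
  have hinv : (n : ℝ)⁻¹ ≤ 1 / 2 := by
    rw [one_div]; gcongr
  have hinv0 : 0 < (n : ℝ)⁻¹ := inv_pos.2 hn0
  have h := hT.choose_mul_norm_pow_le hk n (r := 1 - (n : ℝ)⁻¹) (by linarith) (by linarith)
  rw [sub_sub_cancel, Real.inv_rpow hn0.le, div_inv_eq_mul, Real.log_inv, sub_neg_eq_add] at h
  have hlog : Real.log ((n : ℝ)⁻¹ + 2 * π) + Real.log n ≤ 4 * Real.log n := by
    have h8 : Real.log ((n : ℝ)⁻¹ + 2 * π) ≤ Real.log ((n : ℝ) ^ 3) := by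
      apply Real.log_le_log (by positivity)
      have : (2 : ℝ) ^ 3 ≤ (n : ℝ) ^ 3 := by gcongr
      linarith [Real.pi_lt_d2]
    rw [Real.log_pow] at h8
    push_cast at h8
    linarith
  have hr : 0 ≤ (1 - (n : ℝ)⁻¹)⁻¹ := inv_nonneg.2 (by linarith)
  have hexp : (1 - (n : ℝ)⁻¹)⁻¹ ^ n ≤ Real.exp 2 := by
    have h1 : (1 - (n : ℝ)⁻¹)⁻¹ ≤ Real.exp (2 * (n : ℝ)⁻¹) := by
      refine le_trans ?_ (Real.add_one_le_exp _)
      rw [inv_le_iff_one_le_mul₀ (by linarith)]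
      nlinarith
    calc _ ≤ Real.exp (2 * (n : ℝ)⁻¹) ^ n := by
          gcongr
      _ = _ := by
        rw [← Real.exp_nat_mul]
        congr 1
        field_simp
  have hlogn : 0 ≤ Real.log n := Real.log_nonneg (by linarith)
  have hchoose : (n : ℝ) ^ k ≤ k.factorial * (n + k).choose k := by
    have h1 := Nat.pow_sub_le_descFactorial (n + k) k
    rw [Nat.descFactorial_eq_factorial_mul_choose] at h1
    have h2 : n ^ k ≤ (n + k + 1 - k) ^ k := Nat.pow_le_pow_left (by omega) k
    exact_mod_cast h2.trans h1
  have hpow : (n : ℝ) ^ ((k : ℝ) * (β - 1) + β) = (n : ℝ) ^ (β * (k + 1)) / (n : ℝ) ^ k := by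
    rw [← Real.rpow_natCast, ← Real.rpow_sub hn0]
    congr 1
    ring
  rw [hpow]
  have key : ‖T ^ n‖ * (n : ℝ) ^ k ≤ k.factorial * (C ^ (k + 1) * 32 * Real.exp 2) *
      (n : ℝ) ^ (β * (k + 1)) * Real.log n := by
    calc ‖T ^ n‖ * (n : ℝ) ^ k ≤ ‖T ^ n‖ * (k.factorial * (n + k).choose k) := by gcongr
      _ = k.factorial * ((n + k).choose k * ‖T ^ n‖) := by ring
      _ ≤ k.factorial * (C ^ (k + 1) * (n : ℝ) ^ (β * (k + 1)) * (8 * (4 * Real.log n)) *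
          Real.exp 2) := by
        refine mul_le_mul_of_nonneg_left (h.trans ?_) (by positivity)
        have := pow_nonneg hr n
        gcongr
      _ = _ := by ring
  rw [mul_div_assoc', div_mul_eq_mul_div, le_div_iff₀ (by positivity)]
  exact key
end

section
/- Let T be an (α,β)-RK operator on a complex Banach space X with 0 < α ≤ 1 and α + β = 1. Then T is power bounded, i.e. sup_{n ∈ ℕ} ‖T^n‖ < ∞. -/
open Filter Topology in
/-- Cauchy's estimate in mean for the coefficients of a power series. -/
lemma norm_coeff_le_of_hasSum_of_differentiableOn {E : Type*} [NormedAddCommGroup E]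
    [NormedSpace ℂ E] [CompleteSpace E] {f : ℂ → E} {a : ℕ → E} {r : ℝ} (hr : 0 < r)
    (hf : DifferentiableOn ℂ f (Metric.closedBall 0 r))
    (ha : ∀ᶠ z in 𝓝 (0 : ℂ), HasSum (fun n => z ^ n • a n) (f z)) (n : ℕ) :
    ‖a n‖ ≤ ((2 * Real.pi)⁻¹ * ∫ θ : ℝ in 0..2 * Real.pi, ‖f (circleMap 0 r θ)‖) * r⁻¹ ^ n := by
  set p : FormalMultilinearSeries ℂ ℂ E := fun n => ContinuousMultilinearMap.mkPiRing ℂ (Fin n) (a n)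
    with hp
  have h1 : HasFPowerSeriesAt f p 0 := by
    rw [hasFPowerSeriesAt_iff]
    filter_upwards [ha] with z hz
    simpa [hp, FormalMultilinearSeries.coeff] using hz
  lift r to NNReal using hr.le
  have h2 : HasFPowerSeriesAt f (cauchyPowerSeries f 0 r) 0 :=
    (hf.hasFPowerSeriesOnBall (by exact_mod_cast hr)).hasFPowerSeriesAt
  have h3 := norm_cauchyPowerSeries_le f 0 r n
  rw [← h1.eq_formalMultilinearSeries h2, abs_of_pos hr] at h3
  simpa [hp] using h3

/-- The mean of `1 / |1 - z|²` over the circle of radius `r < 1`. -/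
lemma integral_inv_norm_one_sub_circleMap_sq {r : ℝ} (hr0 : 0 ≤ r) (hr1 : r < 1) :
    (2 * Real.pi)⁻¹ * ∫ θ : ℝ in 0..2 * Real.pi, (‖1 - circleMap 0 r θ‖ ^ 2)⁻¹ =
      (1 - r ^ 2)⁻¹ := by
  have h := (diffContOnCl_const (𝕜 := ℂ) (s := Metric.ball (0 : ℂ) 1)
    (c := (1 : ℂ))).circleAverage_poissonKernel_smul (w := (r : ℂ))
    (by simpa [abs_of_nonneg hr0] using hr1)
  have hpos : 0 < 1 - r ^ 2 := by nlinarith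
  have key : ∀ θ : ℝ, poissonKernel 0 (r : ℂ) (circleMap 0 1 θ) =
      (1 - r ^ 2) * (‖1 - circleMap 0 r θ‖ ^ 2)⁻¹ := by
    intro θ
    have e : ‖circleMap 0 1 θ - (r : ℂ)‖ = ‖1 - circleMap 0 r θ‖ := by
      have e1 : 1 - circleMap 0 r θ =
          circleMap 0 1 θ * (starRingEnd ℂ) (circleMap 0 1 θ - (r : ℂ)) := by
        have : circleMap 0 1 θ * (starRingEnd ℂ) (circleMap 0 1 θ) = 1 := by
          rw [Complex.mul_conj, Complex.normSq_eq_norm_sq]; simp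
        rw [map_sub, mul_sub, this, Complex.conj_ofReal]
        simp [circleMap, mul_comm]
      rw [e1, norm_mul, RCLike.norm_conj]; simp
    rw [poissonKernel_def]
    simp [e, div_eq_mul_inv]
  rw [Real.circleAverage] at h
  simp only [Pi.smul_apply', key] at h
  have h' : (2 * Real.pi)⁻¹ * ∫ θ : ℝ in 0..2 * Real.pi,
      (1 - r ^ 2) * (‖1 - circleMap 0 r θ‖ ^ 2)⁻¹ = 1 := by
    have := congrArg Complex.re h
    simp only [Complex.real_smul, mul_one, intervalIntegral.integral_ofReal] at this
    exact_mod_cast this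
  rw [intervalIntegral.integral_const_mul] at h'
  field_simp
  field_simp at h'
  linarith

/-- The resolvent bound of an `(α, β)`-RK operator with `α + β = 1` self-improves to the
Ritt condition. -/
lemma IsRK.exists_norm_inverse_le {X : Type*} [NormedAddCommGroup X] [NormedSpace ℂ X]
    {T : X →L[ℂ] X} {α β C : ℝ} (hα0 : 0 < α) (hα1 : α ≤ 1) (hβ : 0 ≤ β)
    (hsum : α + β = 1) (hT : IsRK T α β C) :
    ∃ K : ℝ, ∀ lam : ℂ, 1 < ‖lam‖ →
      ‖Ring.inverse (algebraMap ℂ (X →L[ℂ] X) lam - T)‖ ≤ K / ‖lam - 1‖ := by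
  obtain ⟨hC, hT⟩ := hT
  set c : ℝ := (4 * C)⁻¹ ^ α⁻¹ with hc
  have hb : 0 < (4 * C)⁻¹ := by positivity
  have hb1 : (4 * C)⁻¹ ≤ 1 / 2 := by
    rw [inv_le_comm₀ (by positivity) (by positivity)]; norm_num; linarith
  have hc0 : 0 < c := by positivity
  have hcα : c ^ α = (4 * C)⁻¹ := by
    rw [hc, ← Real.rpow_mul hb.le, inv_mul_cancel₀ hα0.ne', Real.rpow_one]
  have hc2 : c ≤ 1 / 2 := by
    refine le_trans ?_ hb1
    calc c ≤ (4 * C)⁻¹ ^ (1 : ℝ) :=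
          Real.rpow_le_rpow_of_exponent_ge hb (by linarith) ((one_le_inv₀ hα0).2 hα1)
      _ = _ := Real.rpow_one _
  have hcβ : c ^ β = c * (4 * C) := by
    rw [show β = 1 - α by linarith, Real.rpow_sub hc0, Real.rpow_one, hcα, div_inv_eq_mul]
  refine ⟨c⁻¹, fun lam hlam => ?_⟩
  set d := ‖lam - 1‖ with hd
  have hd0 : 0 < d := norm_pos_iff.2 (sub_ne_zero.2 (by rintro rfl; simp at hlam))
  set mu : ℂ := lam + ((c * d / ‖lam‖ : ℝ) : ℂ) * lam with hmu
  have hl0 : 0 < ‖lam‖ := by linarith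
  have hdist : ‖mu - lam‖ = c * d := by
    rw [hmu, add_sub_cancel_left, norm_mul, Complex.norm_real, Real.norm_of_nonneg (by positivity)]
    field_simp
  have hmun : ‖mu‖ = ‖lam‖ + c * d := by
    rw [show mu = ((1 + c * d / ‖lam‖ : ℝ) : ℂ) * lam by rw [hmu]; push_cast; ring, norm_mul,
      Complex.norm_real, Real.norm_of_nonneg (by positivity)]
    field_simp
  have hmu1 : d / 2 ≤ ‖mu - 1‖ := by
    have : d ≤ ‖mu - 1‖ + ‖mu - lam‖ := by
      rw [hd, show lam - 1 = (mu - 1) - (mu - lam) by ring]; exact norm_sub_le _ _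
    rw [hdist] at this
    nlinarith
  have hcd : 0 < c * d := by positivity
  obtain ⟨uL, -⟩ := hT lam hlam
  obtain ⟨uM, hM⟩ := hT mu (by linarith)
  set L := algebraMap ℂ (X →L[ℂ] X) lam - T with hL
  set M := algebraMap ℂ (X →L[ℂ] X) mu - T with hMdef
  have hML : M - L = (mu - lam) • (1 : X →L[ℂ] X) := by
    rw [hL, hMdef, sub_sub_sub_cancel_right, ← map_sub, Algebra.algebraMap_eq_smul_one]
  have hMn : ‖Ring.inverse M‖ ≤ (2 * c * d)⁻¹ := by
    refine hM.trans ?_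
    rw [hsum, sub_self, Real.rpow_zero, mul_one]
    have hden : d / 2 * (c * (4 * C)) ≤ ‖mu - 1‖ ^ α * (‖mu‖ - 1) ^ β := by
      calc d / 2 * (c * (4 * C)) = (d / 2) ^ (α + β) * c ^ β := by
            rw [hsum, Real.rpow_one, hcβ]
        _ = (d / 2) ^ α * ((d / 2) * c) ^ β := by
            rw [Real.rpow_add (by positivity), Real.mul_rpow (by positivity) hc0.le, mul_assoc]
        _ ≤ _ := by
            gcongr
            rw [hmun]; nlinarith
    calc C / (‖mu - 1‖ ^ α * (‖mu‖ - 1) ^ β) ≤ C / (d / 2 * (c * (4 * C))) := by gcongr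
      _ = (2 * c * d)⁻¹ := by field_simp; norm_num
  have hres : Ring.inverse L = Ring.inverse M + (mu - lam) • (Ring.inverse M * Ring.inverse L) := by
    have : Ring.inverse M * (M - L) * Ring.inverse L = Ring.inverse L - Ring.inverse M := by
      rw [mul_sub, Ring.inverse_mul_cancel _ uM, sub_mul, one_mul, mul_assoc,
        Ring.mul_inverse_cancel _ uL, mul_one]
    rw [hML, mul_smul_comm, mul_one, smul_mul_assoc] at this
    rw [this]; abel
  have hfin : ‖Ring.inverse L‖ ≤ (2 * c * d)⁻¹ + 1 / 2 * ‖Ring.inverse L‖ := by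
    calc ‖Ring.inverse L‖ = ‖Ring.inverse M + (mu - lam) • (Ring.inverse M * Ring.inverse L)‖ := by
          rw [← hres]
      _ ≤ ‖Ring.inverse M‖ + c * d * (‖Ring.inverse M‖ * ‖Ring.inverse L‖) := by
          refine (norm_add_le _ _).trans ?_
          rw [norm_smul, hdist]
          gcongr
          exact norm_mul_le _ _
      _ ≤ (2 * c * d)⁻¹ + c * d * ((2 * c * d)⁻¹ * ‖Ring.inverse L‖) := by gcongr
      _ = _ := by field_simp
  have : (2 * c * d)⁻¹ * 2 = c⁻¹ / d := by field_simp
  linarith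

open Filter Topology in
/-- A Ritt operator is power bounded. -/
lemma exists_norm_pow_le_of_norm_inverse_le {X : Type*} [NormedAddCommGroup X] [NormedSpace ℂ X]
    [CompleteSpace X] {T : X →L[ℂ] X} {K : ℝ}
    (hu : ∀ lam : ℂ, 1 < ‖lam‖ → IsUnit (algebraMap ℂ (X →L[ℂ] X) lam - T))
    (hK : ∀ lam : ℂ, 1 < ‖lam‖ →
      ‖Ring.inverse (algebraMap ℂ (X →L[ℂ] X) lam - T)‖ ≤ K / ‖lam - 1‖) :
    ∃ M : ℝ, ∀ n : ℕ, ‖T ^ n‖ ≤ M := by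
  have hfac : ∀ z : ℂ, z ≠ 0 → 1 - z • T = z • (algebraMap ℂ (X →L[ℂ] X) z⁻¹ - T) := by
    intro z hz
    rw [smul_sub, Algebra.algebraMap_eq_smul_one, smul_smul, mul_inv_cancel₀ hz, one_smul]
  have hinv : ∀ z : ℂ, z ≠ 0 → ‖z‖ < 1 → 1 < ‖z⁻¹‖ := by
    intro z hz h
    rw [norm_inv]; exact (one_lt_inv₀ (norm_pos_iff.2 hz)).2 h
  have hunit : ∀ z : ℂ, ‖z‖ < 1 → IsUnit (1 - z • T) := by
    intro z hz
    rcases eq_or_ne z 0 with rfl | h0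
    · simp
    · rw [hfac z h0]
      exact (hu _ (hinv z h0 hz)).smul (Units.mk0 z h0)
  have hbound : ∀ z : ℂ, z ≠ 0 → ‖z‖ < 1 →
      ‖Ring.inverse (1 - z • T) ^ 2‖ ≤ K ^ 2 * (‖1 - z‖ ^ 2)⁻¹ := by
    intro z h0 hz
    have e : Ring.inverse (1 - z • T) =
        z⁻¹ • Ring.inverse (algebraMap ℂ (X →L[ℂ] X) z⁻¹ - T) := by
      have u := hu _ (hinv z h0 hz)
      apply (hunit z hz).mul_left_cancel
      rw [Ring.mul_inverse_cancel _ (hunit z hz), hfac z h0, smul_mul_smul_comm,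
        Ring.mul_inverse_cancel _ u, mul_inv_cancel₀ h0, one_smul]
    have h1 : ‖Ring.inverse (1 - z • T)‖ ≤ K / ‖1 - z‖ := by
      rw [e, norm_smul]
      calc _ ≤ ‖z⁻¹‖ * (K / ‖z⁻¹ - 1‖) := by gcongr; exact hK _ (hinv z h0 hz)
        _ = K / ‖1 - z‖ := by
          rw [show z⁻¹ - 1 = z⁻¹ * (1 - z) by field_simp, norm_mul]
          have : ‖z⁻¹‖ ≠ 0 := by simpa using h0
          rw [← mul_div_assoc, mul_div_mul_left _ _ this]
    calc _ ≤ ‖Ring.inverse (1 - z • T)‖ ^ 2 := norm_pow_le' _ two_pos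
      _ ≤ (K / ‖1 - z‖) ^ 2 := by gcongr
      _ = _ := by rw [div_pow, div_eq_mul_inv]
  have hdiff : ∀ r : ℝ, r < 1 →
      DifferentiableOn ℂ (fun z : ℂ => Ring.inverse (1 - z • T) ^ 2) (Metric.closedBall 0 r) := by
    intro r hr z hz
    have hz' : ‖z‖ < 1 := lt_of_le_of_lt (by simpa using hz) hr
    have h1 : DifferentiableAt ℂ (fun z : ℂ => Ring.inverse (1 - z • T)) z :=
      DifferentiableAt.comp (g := Ring.inverse) z (differentiableAt_inverse (hunit z hz'))
        (by fun_prop)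
    exact (h1.pow 2).differentiableWithinAt
  have hsum : ∀ᶠ z in 𝓝 (0 : ℂ), HasSum (fun n : ℕ => z ^ n • ((n + 1 : ℂ) • T ^ n))
      (Ring.inverse (1 - z • T) ^ 2) := by
    have : Tendsto (fun z : ℂ => ‖z • T‖) (𝓝 0) (𝓝 0) := by
      have : Continuous fun z : ℂ => ‖z • T‖ := by fun_prop
      simpa using this.tendsto 0
    filter_upwards [this.eventually_lt_const one_pos] with z hz
    convert! hasSum_choose_mul_geometric_of_norm_lt_one' 1 hz using 2 with n
    rw [Nat.choose_one_right, smul_pow, ← nsmul_eq_mul, smul_comm, ← Nat.cast_smul_eq_nsmul ℂ]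
    push_cast; rfl
  refine ⟨2 * K ^ 2 * Real.exp 1, fun n => ?_⟩
  set r : ℝ := (n + 1) / (n + 2) with hr
  have hr0 : 0 < r := by positivity
  have hr1 : r < 1 := by rw [hr, div_lt_one (by positivity)]; linarith
  have h := norm_coeff_le_of_hasSum_of_differentiableOn hr0 (hdiff r hr1) hsum n
  have hne : ∀ θ : ℝ, circleMap 0 r θ ≠ 0 := fun θ => circleMap_ne_center hr0.ne'
  have hlt : ∀ θ : ℝ, ‖circleMap 0 r θ‖ < 1 := fun θ => by simpa [abs_of_pos hr0] using hr1
  have hmean : (2 * Real.pi)⁻¹ * ∫ θ : ℝ in 0..2 * Real.pi,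
      ‖Ring.inverse (1 - circleMap 0 r θ • T) ^ 2‖ ≤ K ^ 2 * (1 - r ^ 2)⁻¹ := by
    rw [← integral_inv_norm_one_sub_circleMap_sq hr0.le hr1, mul_left_comm,
      ← intervalIntegral.integral_const_mul (K ^ 2)]
    refine mul_le_mul_of_nonneg_left ?_ (inv_nonneg.2 Real.two_pi_pos.le)
    refine intervalIntegral.integral_mono_on Real.two_pi_pos.le ?_ ?_
      (fun θ _ => hbound _ (hne θ) (hlt θ))
    · refine Continuous.intervalIntegrable (Continuous.norm ?_) _ _
      exact (hdiff r hr1).continuousOn.comp_continuous (continuous_circleMap 0 r)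
        (fun θ => by simp [abs_of_pos hr0])
    · refine Continuous.intervalIntegrable (continuous_const.mul (Continuous.inv₀ ?_ ?_)) _ _
      · have := continuous_circleMap 0 r
        fun_prop
      · intro θ h0
        have : (1 : ℂ) = circleMap 0 r θ := by simpa [sub_eq_zero] using h0
        exact absurd (hlt θ) (by simp [← this])
  have hexp : r⁻¹ ^ n ≤ Real.exp 1 := by
    have h1 : r⁻¹ ≤ Real.exp (1 / (n + 1)) := by
      have : r⁻¹ = 1 / (n + 1) + 1 := by rw [hr]; field_simp; ring
      rw [this]; exact Real.add_one_le_exp _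
    calc r⁻¹ ^ n ≤ Real.exp (1 / (n + 1)) ^ n := by gcongr
      _ = Real.exp (n * (1 / (n + 1))) := (Real.exp_nat_mul _ _).symm
      _ ≤ Real.exp 1 := by
        gcongr
        rw [mul_one_div, div_le_one (by positivity)]; linarith
  have hgap : (1 - r ^ 2)⁻¹ ≤ 2 * ((n : ℝ) + 1) := by
    have : 1 - r ^ 2 = (2 * n + 3) / (n + 2) ^ 2 := by rw [hr]; field_simp; ring
    rw [this, inv_div, div_le_iff₀ (by positivity)]
    nlinarith [(Nat.cast_nonneg n : (0 : ℝ) ≤ n)]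
  have hnorm : ‖(n + 1 : ℂ) • T ^ n‖ = (n + 1) * ‖T ^ n‖ := by
    rw [norm_smul]
    congr 1
    exact_mod_cast Complex.norm_natCast (n + 1)
  rw [hnorm] at h
  have : ((n : ℝ) + 1) * ‖T ^ n‖ ≤ (n + 1) * (2 * K ^ 2 * Real.exp 1) := by
    calc _ ≤ _ := h
      _ ≤ (K ^ 2 * (2 * (n + 1))) * Real.exp 1 := by
        refine mul_le_mul (hmean.trans (by gcongr)) hexp (by positivity) (by positivity)
      _ = _ := by ring
  exact le_of_mul_le_mul_left this (by positivity)

/-- An `(α,β)`-RK operator with `0 < α ≤ 1` and `α + β = 1` is power bounded. -/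
theorem power_bounded_of_sum_eq_one
    {X : Type*} [NormedAddCommGroup X] [NormedSpace ℂ X] [CompleteSpace X]
    (T : X →L[ℂ] X) (α β C : ℝ) (hα0 : 0 < α) (hα1 : α ≤ 1) (hβ : 0 ≤ β)
    (hsum : α + β = 1) (hT : IsRK T α β C) :
    ∃ M : ℝ, ∀ n : ℕ, ‖T ^ n‖ ≤ M := by
  obtain ⟨K, hK⟩ := hT.exists_norm_inverse_le hα0 hα1 hβ hsum
  exact exists_norm_pow_le_of_norm_inverse_le (fun lam hlam => (hT.2 lam hlam).1) hK
end
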